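/- Let {ν_{nk}} be an infinitesimal array of probability measures on ℝ, {c_n}_{n≥1} ⊂ ℝ, γ ∈ ℝ, and σ a finite positive Borel measure on ℝ. For each n, let ω_n be a Borel probability measure on ℝ with E_{ω_n}(z) = c_n + Σ_{k=1}^{k_n} E_{ν_{nk}}(z) for all z ∈ ℂ⁺ (the additive boolean convolution δ_{c_n} ⊎ ν_{n1} ⊎ ⋯ ⊎ ν_{nk_n}), and let ν be the Borel probability measure with E_ν(z) = γ + ∫_ℝ (1+tz)/(z−t) dσ(t) for all z ∈ ℂ⁺. Then the classical convolutions ρ_n = δ_{c_n} * ν_{n1} * ν_{n2} * ⋯ * ν_{nk_n} converge weakly to the *-infinitely divisible measure ν_*^{γ,σ} if and only if ω_n converges weakly to ν. -/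

import Mathlib

open MeasureTheory Complex Filter Topology

noncomputable section

/-- Cauchy transform G_μ(z) = ∫ (z−t)⁻¹ dμ(t), z ∈ ℂ⁺. -/
def cauchyT (μ : Measure ℝ) (z : ℂ) : ℂ := ∫ t : ℝ, (z - (t : ℂ))⁻¹ ∂μ

/-- E_μ(z) = z − F_μ(z), where F_μ = 1/G_μ. -/
def ET (μ : Measure ℝ) (z : ℂ) : ℂ := z - (cauchyT μ z)⁻¹

/-- Infinitesimal triangular array on ℝ: max_{1≤k≤k_n} ν_{nk}{|t| ≥ ε} → 0 as n → ∞. -/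
def IsInfinitesimalArrayR (kn : ℕ → ℕ) (ν : ℕ → ℕ → Measure ℝ) : Prop :=
  ∀ ε : ℝ, 0 < ε → ∀ δ : ENNReal, 0 < δ → ∃ N : ℕ, ∀ n ≥ N, ∀ i < kn n,
    ν n i {t : ℝ | ε ≤ |t|} < δ

/-- a = ∫_{|t|<1} t dν(t). -/
def aR (ν : Measure ℝ) : ℝ := ∫ t in {t : ℝ | |t| < 1}, t ∂ν

/-- ν° : the centering of ν, pushforward under t ↦ t − a. -/
def centerR (ν : Measure ℝ) : Measure ℝ := Measure.map (fun t => t - aR ν) ν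

/-- f(z) = ∫ tz/(z−t) dν°(t). -/
def fR (ν : Measure ℝ) (z : ℂ) : ℂ :=
  ∫ t : ℝ, ((t : ℂ) * z) / (z - (t : ℂ)) ∂(centerR ν)

/-- Iterated classical (additive) convolution ν_0 ∗ ν_1 ∗ ⋯ ∗ ν_{m-1} (δ_0 for m = 0). -/
def convSeq (ν : ℕ → Measure ℝ) : ℕ → Measure ℝ
  | 0 => Measure.dirac (0 : ℝ)
  | m + 1 => Measure.conv (convSeq ν m) (ν m)

/-- The classical convolution ρ_n = δ_{c_n} * ν_{n1} * ν_{n2} * ⋯ * ν_{nk_n}. -/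
def rhoN (c : ℕ → ℝ) (kn : ℕ → ℕ) (ν : ℕ → ℕ → Measure ℝ) (n : ℕ) : Measure ℝ :=
  Measure.conv (Measure.dirac (c n)) (convSeq (ν n) (kn n))

/-- The integrand in the Lévy–Hinčin formula:
(e^{itx} − 1 − itx/(1+x²))·(1+x²)/x², interpreted as −t²/2 at x = 0. -/
def levyKernel (t x : ℝ) : ℂ :=
  if x = 0 then -((t : ℂ) ^ 2) / 2
  else (Complex.exp (Complex.I * t * x) - 1 - Complex.I * t * x / (1 + (x : ℂ) ^ 2))
      * ((1 + (x : ℂ) ^ 2) / (x : ℂ) ^ 2)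

open scoped BoundedContinuousFunction

lemma sub_ofReal_ne_zero {z : ℂ} (hz : z.im ≠ 0) (t : ℝ) : z - (t : ℂ) ≠ 0 := by
  intro h
  apply hz
  simpa using congrArg Complex.im h

lemma abs_im_le_norm_sub_ofReal (z : ℂ) (t : ℝ) : |z.im| ≤ ‖z - (t : ℂ)‖ := by
  simpa using Complex.abs_im_le_norm (z - (t : ℂ))

lemma continuous_resolvent {z : ℂ} (hz : z.im ≠ 0) :
    Continuous fun t : ℝ => (z - (t : ℂ))⁻¹ :=
  Continuous.inv₀ (by fun_prop) (sub_ofReal_ne_zero hz)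

lemma norm_resolvent_le {z : ℂ} (hz : z.im ≠ 0) (t : ℝ) :
    ‖(z - (t : ℂ))⁻¹‖ ≤ |z.im|⁻¹ := by
  rw [norm_inv]
  exact inv_anti₀ (by positivity) (abs_im_le_norm_sub_ofReal z t)

lemma integrable_resolvent (μ : Measure ℝ) [IsFiniteMeasure μ] {z : ℂ} (hz : z.im ≠ 0) :
    Integrable (fun t : ℝ => (z - (t : ℂ))⁻¹) μ :=
  Integrable.of_bound (continuous_resolvent hz).aestronglyMeasurable |z.im|⁻¹
    (ae_of_all _ (norm_resolvent_le hz))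

/-- The constant `1` together with the resolvent functions `t ↦ (z - t)⁻¹`, `|Im z| > 1`. -/
def resolventFamily : Set (ℝ →ᵇ ℂ) :=
  {φ | φ = 1 ∨ ∃ z : ℂ, 1 < |z.im| ∧ ∀ t : ℝ, φ t = (z - (t : ℂ))⁻¹}

lemma im_ne_zero_of_one_lt {z : ℂ} (hz : 1 < |z.im|) : z.im ≠ 0 := by
  intro h
  simp [h] at hz
  linarith

lemma exists_resolvent {z : ℂ} (hz : 1 < |z.im|) :
    ∃ φ : ℝ →ᵇ ℂ, ∀ t : ℝ, φ t = (z - (t : ℂ))⁻¹ :=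
  ⟨BoundedContinuousFunction.ofNormedAddCommGroup _
    (continuous_resolvent (im_ne_zero_of_one_lt hz)) _
    (norm_resolvent_le (im_ne_zero_of_one_lt hz)), fun _ => rfl⟩

/-- The closed linear span of `resolventFamily`. -/
def resolventSpan : Submodule ℂ (ℝ →ᵇ ℂ) := (Submodule.span ℂ resolventFamily).topologicalClosure

lemma isClosed_resolventSpan : IsClosed (resolventSpan : Set (ℝ →ᵇ ℂ)) :=
  Submodule.isClosed_topologicalClosure _

lemma subset_resolventSpan : resolventFamily ⊆ resolventSpan :=
  Submodule.subset_span.trans (Submodule.le_topologicalClosure _)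

lemma resolvent_mul_resolvent_mem_of_ne {z w : ℂ} (hz : 1 < |z.im|) (hw : 1 < |w.im|)
    (hzw : z ≠ w) {φ ψ : ℝ →ᵇ ℂ} (hφ : ∀ t : ℝ, φ t = (z - (t : ℂ))⁻¹)
    (hψ : ∀ t : ℝ, ψ t = (w - (t : ℂ))⁻¹) : φ * ψ ∈ resolventSpan := by
  have h : φ * ψ = (w - z)⁻¹ • (φ - ψ) := by
    ext t
    have h1 := sub_ofReal_ne_zero (im_ne_zero_of_one_lt hz) t
    have h2 := sub_ofReal_ne_zero (im_ne_zero_of_one_lt hw) t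
    have h3 : w - z ≠ 0 := sub_ne_zero.2 (Ne.symm hzw)
    simp only [BoundedContinuousFunction.coe_mul, Pi.mul_apply, BoundedContinuousFunction.coe_smul,
      BoundedContinuousFunction.coe_sub, Pi.sub_apply, hφ, hψ, smul_eq_mul]
    field_simp
    ring
  rw [h]
  exact Submodule.smul_mem _ _ (Submodule.sub_mem _
    (subset_resolventSpan (Or.inr ⟨z, hz, hφ⟩)) (subset_resolventSpan (Or.inr ⟨w, hw, hψ⟩)))

lemma norm_resolvent_sub_le {z w : ℂ} (hz : 1 < |z.im|) (hw : 1 < |w.im|) (t : ℝ) :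
    ‖(z - (t : ℂ))⁻¹ - (w - (t : ℂ))⁻¹‖ ≤ ‖w - z‖ := by
  have h1 := sub_ofReal_ne_zero (im_ne_zero_of_one_lt hz) t
  have h2 := sub_ofReal_ne_zero (im_ne_zero_of_one_lt hw) t
  have h3 := norm_resolvent_le (im_ne_zero_of_one_lt hz) t
  have h4 := norm_resolvent_le (im_ne_zero_of_one_lt hw) t
  have h5 : |z.im|⁻¹ ≤ 1 := inv_le_one_of_one_le₀ hz.le
  have h6 : |w.im|⁻¹ ≤ 1 := inv_le_one_of_one_le₀ hw.le
  have h : (z - (t : ℂ))⁻¹ - (w - (t : ℂ))⁻¹ = (w - z) * ((z - (t : ℂ))⁻¹ * (w - (t : ℂ))⁻¹) := by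
    field_simp
    ring
  rw [h, norm_mul, norm_mul]
  refine mul_le_of_le_one_right (norm_nonneg _) (mul_le_one₀ (h3.trans h5) (norm_nonneg _)
    (h4.trans h6))

lemma resolvent_mul_resolvent_mem {z w : ℂ} (hz : 1 < |z.im|) (hw : 1 < |w.im|)
    {φ ψ : ℝ →ᵇ ℂ} (hφ : ∀ t : ℝ, φ t = (z - (t : ℂ))⁻¹)
    (hψ : ∀ t : ℝ, ψ t = (w - (t : ℂ))⁻¹) : φ * ψ ∈ resolventSpan := by
  by_cases hzw : z = w
  swap
  · exact resolvent_mul_resolvent_mem_of_ne hz hw hzw hφ hψ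
  subst hzw
  have him (n : ℕ) : 1 < |(z + ((1 / ((n : ℝ) + 1) : ℝ) : ℂ)).im| := by simpa using hz
  choose u hu using fun n : ℕ => exists_resolvent (him n)
  have hlim : Tendsto u atTop (𝓝 ψ) := by
    rw [tendsto_iff_norm_sub_tendsto_zero]
    refine squeeze_zero (fun _ => norm_nonneg _) (fun n => ?_)
      tendsto_one_div_add_atTop_nhds_zero_nat
    refine (BoundedContinuousFunction.norm_le (by positivity)).2 fun t => ?_
    rw [BoundedContinuousFunction.coe_sub, Pi.sub_apply, hu, hψ]
    refine (norm_resolvent_sub_le (him n) hz t).trans_eq ?_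
    rw [sub_add_cancel_left, norm_neg, Complex.norm_real, Real.norm_of_nonneg (by positivity)]
  refine isClosed_resolventSpan.mem_of_tendsto (hlim.const_mul φ)
    (Eventually.of_forall fun n => ?_)
  refine resolvent_mul_resolvent_mem_of_ne hz (him n) ?_ hφ (hu n)
  intro h
  have h0 : ((1 / ((n : ℝ) + 1) : ℝ) : ℂ) = 0 := by
    linear_combination -h
  rw [Complex.ofReal_eq_zero] at h0
  have : 0 < 1 / ((n : ℝ) + 1) := by positivity
  linarith

lemma mul_mem_resolventSpan {φ ψ : ℝ →ᵇ ℂ} (hφ : φ ∈ resolventSpan) (hψ : ψ ∈ resolventSpan) :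
    φ * ψ ∈ resolventSpan := by
  have hspan :
      Submodule.span ℂ resolventFamily * Submodule.span ℂ resolventFamily ≤ resolventSpan := by
    rw [Submodule.span_mul_span, Submodule.span_le]
    rintro _ ⟨φ, hφ, ψ, hψ, rfl⟩
    rcases hφ with rfl | ⟨z, hz, hφ⟩
    · simpa using subset_resolventSpan hψ
    rcases hψ with rfl | ⟨w, hw, hψ⟩
    · simpa using subset_resolventSpan (Or.inr ⟨z, hz, hφ⟩)
    exact resolvent_mul_resolvent_mem hz hw hφ hψ
  have h := map_mem_closure₂ (continuous_mul (M := ℝ →ᵇ ℂ)) hφ hψ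
    (u := (resolventSpan : Set (ℝ →ᵇ ℂ))) fun a ha b hb => hspan (Submodule.mul_mem_mul ha hb)
  rwa [isClosed_resolventSpan.closure_eq] at h

lemma star_mem_resolventSpan {φ : ℝ →ᵇ ℂ} (hφ : φ ∈ resolventSpan) :
    star φ ∈ resolventSpan := by
  have hspan : ∀ φ ∈ Submodule.span ℂ resolventFamily, star φ ∈ resolventSpan := by
    intro φ hφ
    induction hφ using Submodule.span_induction with
    | mem φ h =>
      refine subset_resolventSpan ?_
      rcases h with rfl | ⟨z, hz, hφ⟩
      · exact Or.inl (by simp)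
      · refine Or.inr ⟨starRingEnd ℂ z, by simpa using hz, fun t => ?_⟩
        simp [hφ]
    | zero => simp
    | add x y _ _ hx hy => simpa using Submodule.add_mem _ hx hy
    | smul a x _ hx => simpa using Submodule.smul_mem _ _ hx
  have h := map_mem_closure (continuous_star (R := ℝ →ᵇ ℂ)) hφ
    (t := (resolventSpan : Set (ℝ →ᵇ ℂ))) hspan
  rwa [isClosed_resolventSpan.closure_eq] at h

/-- The closed linear span of `resolventFamily`, as a star subalgebra. -/
def resolventAlgebra : StarSubalgebra ℂ (ℝ →ᵇ ℂ) :=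
  { resolventSpan.toSubalgebra (subset_resolventSpan (Or.inl rfl))
      fun _ _ => mul_mem_resolventSpan with
    star_mem' := star_mem_resolventSpan }

lemma resolventAlgebra_separatesPoints :
    (resolventAlgebra.map (BoundedContinuousFunction.toContinuousMapStarₐ ℂ)).SeparatesPoints := by
  intro x y hxy
  have hz : 1 < |(2 * I : ℂ).im| := by simp
  obtain ⟨φ, hφ⟩ := exists_resolvent hz
  refine ⟨φ, ⟨BoundedContinuousFunction.toContinuousMapStarₐ ℂ φ,
    ⟨φ, subset_resolventSpan (Or.inr ⟨_, hz, hφ⟩), rfl⟩, rfl⟩, ?_⟩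
  rw [hφ, hφ]
  intro h
  rw [inv_inj] at h
  exact hxy (by simpa using h)

lemma tendsto_integral_of_mem_resolventSpan {μ : ℕ → Measure ℝ} [∀ n, IsProbabilityMeasure (μ n)]
    {μ₀ : Measure ℝ} [IsProbabilityMeasure μ₀]
    (h : ∀ z : ℂ, 1 < z.im → Tendsto (fun n => cauchyT (μ n) z) atTop (𝓝 (cauchyT μ₀ z)))
    {φ : ℝ →ᵇ ℂ} (hφ : φ ∈ resolventSpan) :
    Tendsto (fun n => ∫ t, φ t ∂(μ n)) atTop (𝓝 (∫ t, φ t ∂μ₀)) := by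
  have hspan : ∀ ψ ∈ Submodule.span ℂ resolventFamily,
      Tendsto (fun n => ∫ t, ψ t ∂(μ n)) atTop (𝓝 (∫ t, ψ t ∂μ₀)) := by
    intro ψ hψ
    induction hψ using Submodule.span_induction with
    | mem ψ hψ =>
      rcases hψ with rfl | ⟨z, hz, hψ⟩
      · simp
      simp_rw [hψ]
      rcases lt_abs.1 hz with hz | hz
      · exact h z hz
      · have hconj (μ : Measure ℝ) :
            ∫ t : ℝ, (z - (t : ℂ))⁻¹ ∂μ = starRingEnd ℂ (cauchyT μ (starRingEnd ℂ z)) := by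
          rw [cauchyT, ← integral_conj]
          simp
        simp_rw [hconj]
        exact (Complex.continuous_conj.tendsto _).comp (h _ (by simpa using hz))
    | zero => simp
    | add x y _ _ hx hy =>
      have hadd (μ : Measure ℝ) [IsProbabilityMeasure μ] :
          ∫ t, (x + y) t ∂μ = ∫ t, x t ∂μ + ∫ t, y t ∂μ :=
        integral_add (x.integrable μ) (y.integrable μ)
      simp_rw [hadd]
      exact hx.add hy
    | smul a x _ hx =>
      simp only [BoundedContinuousFunction.coe_smul, smul_eq_mul, integral_const_mul]
      exact hx.const_mul a
  have hclose (μ : Measure ℝ) [IsProbabilityMeasure μ] (ψ : ℝ →ᵇ ℂ) :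
      ‖(∫ t, φ t ∂μ) - ∫ t, ψ t ∂μ‖ ≤ ‖φ - ψ‖ := by
    rw [← integral_sub (φ.integrable μ) (ψ.integrable μ)]
    exact (φ - ψ).norm_integral_le_norm μ
  rw [Metric.tendsto_atTop]
  intro ε hε
  obtain ⟨ψ, hψ, hφψ⟩ := Metric.mem_closure_iff.1 hφ (ε / 3) (by positivity)
  obtain ⟨N, hN⟩ := Metric.tendsto_atTop.1 (hspan ψ hψ) (ε / 3) (by positivity)
  refine ⟨N, fun n hn => ?_⟩
  have h1 := hclose (μ n) ψ
  have h2 := hclose μ₀ ψ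
  have h3 := hN n hn
  rw [dist_eq_norm] at h3 hφψ ⊢
  have h4 : (∫ t, φ t ∂(μ n)) - ∫ t, φ t ∂μ₀
      = ((∫ t, φ t ∂(μ n)) - ∫ t, ψ t ∂(μ n)) + ((∫ t, ψ t ∂(μ n)) - ∫ t, ψ t ∂μ₀)
        - ((∫ t, φ t ∂μ₀) - ∫ t, ψ t ∂μ₀) := by ring
  rw [h4]
  calc _ ≤ _ := norm_sub_le _ _
    _ ≤ _ := add_le_add_left (norm_add_le _ _) _
    _ < ε := by linarith

/-- The Cauchy transform at `ir`, rescaled to control the mass outside `[-r, r]`. -/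
lemma one_sub_mul_cauchyT_eq (μ : Measure ℝ) [IsProbabilityMeasure μ] {r : ℝ} (hr : 0 < r) :
    1 + r * (cauchyT μ (r * I)).im = ∫ t : ℝ, t ^ 2 / (r ^ 2 + t ^ 2) ∂μ := by
  have hz : (r * I : ℂ).im ≠ 0 := by simpa using hr.ne'
  have h : (cauchyT μ (r * I)).im = ∫ t : ℝ, ((r * I - (t : ℂ))⁻¹).im ∂μ :=
    (integral_im (integrable_resolvent μ hz)).symm
  have h2 : (1 : ℝ) = ∫ _ : ℝ, (1 : ℝ) ∂μ := by simp
  rw [h, ← integral_const_mul]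
  nth_rewrite 1 [h2]
  have hInt : Integrable (fun t : ℝ => r * ((r * I - (t : ℂ))⁻¹).im) μ :=
    (integrable_resolvent μ hz).im.const_mul r
  rw [← integral_add (integrable_const _) hInt]
  congr with t
  have : r ^ 2 + t ^ 2 ≠ 0 := by positivity
  simp only [Complex.inv_im, Complex.normSq_apply, Complex.sub_re, Complex.sub_im, Complex.mul_re,
    Complex.mul_im, Complex.ofReal_re, Complex.ofReal_im, Complex.I_re, Complex.I_im]
  ring_nf
  linear_combination -(mul_inv_cancel₀ this)

lemma measureReal_norm_gt_le (μ : Measure ℝ) [IsProbabilityMeasure μ] {r : ℝ} (hr : 0 < r) :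
    μ.real {x | r < ‖x‖} ≤ 2 * (1 + r * (cauchyT μ (r * I)).im) := by
  rw [one_sub_mul_cauchyT_eq μ hr, ← integral_const_mul]
  have hm : MeasurableSet {x : ℝ | r < ‖x‖} := measurableSet_lt (by fun_prop) (by fun_prop)
  rw [← integral_indicator_one hm]
  refine integral_mono_of_nonneg (ae_of_all _ fun t => Set.indicator_nonneg (by simp) t) ?_
    (ae_of_all _ fun t => ?_)
  · refine Integrable.const_mul (Integrable.of_bound
      (Measurable.aestronglyMeasurable (by fun_prop)) 1 (ae_of_all _ fun t => ?_)) _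
    rw [Real.norm_of_nonneg (by positivity), div_le_one (by positivity)]
    nlinarith
  · refine Set.indicator_apply_le' (fun ht => ?_) fun _ => by positivity
    simp only [Set.mem_ofPred_eq, Real.norm_eq_abs] at ht
    have h1 : r ^ 2 < t ^ 2 := by
      rw [← sq_abs t]
      gcongr
    simp only [Pi.one_apply]
    rw [mul_div_assoc', le_div_iff₀ (by positivity)]
    linarith

lemma tendsto_one_add_mul_cauchyT (μ : Measure ℝ) [IsProbabilityMeasure μ] :
    Tendsto (fun r : ℝ => 1 + r * (cauchyT μ (r * I)).im) atTop (𝓝 0) := by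
  have h : Tendsto (fun r : ℝ => ∫ t : ℝ, t ^ 2 / (r ^ 2 + t ^ 2) ∂μ) atTop
      (𝓝 (∫ _ : ℝ, (0 : ℝ) ∂μ)) := by
    refine tendsto_integral_filter_of_dominated_convergence (fun _ => 1)
      (Eventually.of_forall fun r => Measurable.aestronglyMeasurable (by fun_prop)) ?_
      (integrable_const _) (ae_of_all _ fun t => ?_)
    · filter_upwards [eventually_gt_atTop 0] with r hr
      refine ae_of_all _ fun t => ?_
      rw [Real.norm_of_nonneg (by positivity), div_le_one (by positivity)]
      nlinarith
    · exact Tendsto.const_div_atTop (tendsto_atTop_add_const_right _ _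
        (tendsto_pow_atTop two_ne_zero)) _
  rw [integral_zero] at h
  refine h.congr' ?_
  filter_upwards [eventually_gt_atTop 0] with r hr
  exact (one_sub_mul_cauchyT_eq μ hr).symm

lemma isTightMeasureSet_of_tendsto_cauchyT {μ : ℕ → Measure ℝ} [∀ n, IsProbabilityMeasure (μ n)]
    {μ₀ : Measure ℝ} [IsProbabilityMeasure μ₀]
    (h : ∀ z : ℂ, 1 < z.im → Tendsto (fun n => cauchyT (μ n) z) atTop (𝓝 (cauchyT μ₀ z))) :
    IsTightMeasureSet (Set.range μ) := by
  refine isTightMeasureSet_range_of_tendsto_limsup_measure_norm_gt ?_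
  have h0 := ENNReal.tendsto_ofReal ((tendsto_one_add_mul_cauchyT μ₀).const_mul 2)
  rw [mul_zero, ENNReal.ofReal_zero] at h0
  refine tendsto_of_tendsto_of_tendsto_of_le_of_le' tendsto_const_nhds h0
    (Eventually.of_forall fun _ => zero_le) ?_
  filter_upwards [eventually_gt_atTop 1] with r hr
  have hr0 : 0 < r := by linarith
  have hlim : Tendsto (fun n => ENNReal.ofReal (2 * (1 + r * (cauchyT (μ n) (r * I)).im))) atTop
      (𝓝 (ENNReal.ofReal (2 * (1 + r * (cauchyT μ₀ (r * I)).im)))) := by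
    refine ENNReal.tendsto_ofReal (Tendsto.const_mul 2 (Tendsto.const_add 1
      (Tendsto.const_mul r ?_)))
    exact (Complex.continuous_im.tendsto _).comp (h _ (by simpa using hr))
  rw [← hlim.limsup_eq]
  refine limsup_le_limsup (Eventually.of_forall fun n => ?_)
  simp only
  rw [← ENNReal.ofReal_toReal (measure_ne_top (μ n) {x | r < ‖x‖})]
  exact ENNReal.ofReal_le_ofReal (measureReal_norm_gt_le (μ n) hr0)

/-- **Stieltjes continuity theorem**: pointwise convergence of Cauchy transforms to the Cauchy
transform of a probability measure implies weak convergence. -/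
theorem tendsto_of_tendsto_cauchyT {μ : ℕ → ProbabilityMeasure ℝ} {μ₀ : ProbabilityMeasure ℝ}
    (h : ∀ z : ℂ, 1 < z.im → Tendsto (fun n => cauchyT (μ n) z) atTop (𝓝 (cauchyT μ₀ z))) :
    Tendsto μ atTop (𝓝 μ₀) :=
  ProbabilityMeasure.tendsto_of_tight_of_separatesPoints ℂ
    (isTightMeasureSet_of_tendsto_cauchyT h) resolventAlgebra_separatesPoints
    fun _ hg => tendsto_integral_of_mem_resolventSpan h hg

/-- Weak convergence of finite measures from convergence of the total masses and of the Cauchy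
transforms. -/
theorem tendsto_integral_of_tendsto_mass_of_tendsto_cauchyT {μ : ℕ → Measure ℝ}
    [∀ n, IsFiniteMeasure (μ n)] {μ₀ : Measure ℝ} [IsFiniteMeasure μ₀]
    (hmass : Tendsto (fun n => (μ n).real Set.univ) atTop (𝓝 (μ₀.real Set.univ)))
    (h : ∀ z : ℂ, 1 < z.im → Tendsto (fun n => cauchyT (μ n) z) atTop (𝓝 (cauchyT μ₀ z)))
    (φ : ℝ →ᵇ ℂ) : Tendsto (fun n => ∫ t, φ t ∂(μ n)) atTop (𝓝 (∫ t, φ t ∂μ₀)) := by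
  let τ (μ : Measure ℝ) : Measure ℝ := (μ Set.univ + 1)⁻¹ • (μ + Measure.dirac 0)
  have hτ (μ : Measure ℝ) [IsFiniteMeasure μ] : IsProbabilityMeasure (τ μ) := by
    constructor
    simp only [τ, Measure.smul_apply, Measure.add_apply, measure_univ, smul_eq_mul]
    exact ENNReal.inv_mul_cancel (by simp) (by simp)
  have hInt (μ : Measure ℝ) [IsFiniteMeasure μ] (f : ℝ → ℂ) (hf : Integrable f μ) :
      ∫ t, f t ∂(τ μ) = ((μ.real Set.univ + 1)⁻¹ : ℝ) • (∫ t, f t ∂μ + f 0) := by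
    simp only [τ]
    rw [integral_smul_measure, integral_add_measure hf (integrable_dirac (by simp)),
      integral_dirac, ENNReal.toReal_inv, ENNReal.toReal_add (by simp) (by simp)]
    rfl
  have hinv : Tendsto (fun n => (((μ n).real Set.univ + 1)⁻¹ : ℝ)) atTop
      (𝓝 ((μ₀.real Set.univ + 1)⁻¹)) :=
    (hmass.add_const 1).inv₀ (by positivity)
  have hG : ∀ z : ℂ, 1 < z.im →
      Tendsto (fun n => cauchyT (τ (μ n)) z) atTop (𝓝 (cauchyT (τ μ₀) z)) := by
    intro z hz
    have hz0 : z.im ≠ 0 := by linarith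
    simp_rw [cauchyT]
    rw [hInt μ₀ _ (integrable_resolvent μ₀ hz0)]
    simp_rw [fun n => hInt (μ n) _ (integrable_resolvent (μ n) hz0)]
    exact hinv.smul ((h z hz).add_const _)
  let ν (n : ℕ) : ProbabilityMeasure ℝ := ⟨τ (μ n), hτ (μ n)⟩
  let ν₀ : ProbabilityMeasure ℝ := ⟨τ μ₀, hτ μ₀⟩
  have hν : Tendsto ν atTop (𝓝 ν₀) := tendsto_of_tendsto_cauchyT hG
  have hweak := (ProbabilityMeasure.tendsto_iff_forall_integral_rclike_tendsto ℂ).1 hν φ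
  have heq (μ : Measure ℝ) [IsFiniteMeasure μ] :
      ∫ t, φ t ∂μ = (μ.real Set.univ + 1) • (∫ t, φ t ∂(τ μ)) - φ 0 := by
    rw [hInt μ _ (φ.integrable μ), smul_inv_smul₀ (by positivity)]
    ring
  rw [heq μ₀]
  simp_rw [fun n => heq (μ n)]
  exact ((hmass.add_const 1).smul hweak).sub_const _

lemma norm_exp_I_mul_sub_one_sub_le (u : ℝ) :
    ‖Complex.exp (I * u) - 1 - I * u‖ ≤ 3 * u ^ 2 := by
  have hu : ‖I * (u : ℂ)‖ = |u| := by simp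
  rcases le_total |u| 1 with h | h
  · have := Complex.norm_exp_sub_one_sub_id_le (x := I * u) (by rw [hu]; exact h)
    rw [hu, sq_abs] at this
    nlinarith [sq_nonneg u]
  · calc ‖Complex.exp (I * u) - 1 - I * u‖
        ≤ ‖Complex.exp (I * u) - 1‖ + ‖I * (u : ℂ)‖ := norm_sub_le _ _
      _ ≤ |u| + |u| := by
        rw [hu]
        gcongr
        simpa using Real.norm_exp_I_mul_ofReal_sub_one_le (x := u)
      _ ≤ 3 * u ^ 2 := by
        rw [← sq_abs u]
        nlinarith

lemma norm_exp_I_mul_sub_one_le_two (u : ℝ) : ‖Complex.exp (I * u) - 1‖ ≤ 2 := by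
  refine (norm_sub_le _ _).trans ?_
  rw [Complex.norm_exp_I_mul_ofReal]
  norm_num

lemma levyKernel_zero (t : ℝ) : levyKernel t 0 = -((t : ℂ) ^ 2) / 2 := by
  simp [levyKernel]

lemma one_add_ofReal_sq_ne_zero (x : ℝ) : (1 + (x : ℂ) ^ 2) ≠ 0 := by
  have h : (1 + x ^ 2 : ℝ) ≠ 0 := by positivity
  exact_mod_cast h

lemma levyKernel_of_ne {x : ℝ} (hx : x ≠ 0) (t : ℝ) :
    levyKernel t x = (Complex.exp (I * (t * x : ℝ)) - 1)
      + (Complex.exp (I * (t * x : ℝ)) - 1 - I * (t * x : ℝ)) / (x : ℂ) ^ 2 := by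
  have h1 := one_add_ofReal_sq_ne_zero x
  have h2 : (x : ℂ) ≠ 0 := by exact_mod_cast hx
  have h3 : Complex.I * t * x = I * (t * x : ℝ) := by push_cast; ring
  rw [levyKernel, if_neg hx, h3]
  field_simp
  ring

/-- The Lévy kernel against the density `x² / (1 + x²)`. -/
lemma levyKernel_mul (t x : ℝ) :
    levyKernel t x * ((x ^ 2 / (1 + x ^ 2) : ℝ) : ℂ)
      = Complex.exp (I * (t * x : ℝ)) - 1 - I * t * ((x / (1 + x ^ 2) : ℝ) : ℂ) := by
  rcases eq_or_ne x 0 with rfl | hx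
  · simp
  · have h1 := one_add_ofReal_sq_ne_zero x
    have h2 : (x : ℂ) ≠ 0 := by exact_mod_cast hx
    have h3 : Complex.I * t * x = I * (t * x : ℝ) := by push_cast; ring
    rw [levyKernel, if_neg hx, h3]
    push_cast
    field_simp

lemma norm_levyKernel_le (t x : ℝ) : ‖levyKernel t x‖ ≤ 2 + 3 * t ^ 2 := by
  rcases eq_or_ne x 0 with rfl | hx
  · have : ‖levyKernel t 0‖ = t ^ 2 / 2 := by simp [levyKernel_zero]
    rw [this]
    nlinarith [sq_nonneg t]
  · rw [levyKernel_of_ne hx]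
    refine (norm_add_le _ _).trans (add_le_add (norm_exp_I_mul_sub_one_le_two _) ?_)
    have hx2 : 0 < x ^ 2 := by positivity
    rw [norm_div, norm_pow, Complex.norm_real, Real.norm_eq_abs, sq_abs, div_le_iff₀ hx2]
    exact (norm_exp_I_mul_sub_one_sub_le _).trans (le_of_eq (by ring))

lemma re_levyKernel_nonpos (t x : ℝ) : (levyKernel t x).re ≤ 0 := by
  rcases eq_or_ne x 0 with rfl | hx
  · rw [levyKernel_zero]
    have : (-((t : ℂ) ^ 2) / 2) = ((-t ^ 2 / 2 : ℝ) : ℂ) := by push_cast; ring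
    rw [this, Complex.ofReal_re]
    nlinarith [sq_nonneg t]
  · rw [levyKernel_of_ne hx]
    have h1 : (Complex.exp (I * (t * x : ℝ))).re ≤ 1 := by
      refine (Complex.re_le_norm _).trans ?_
      rw [Complex.norm_exp_I_mul_ofReal]
    have h2 : (Complex.exp (I * (t * x : ℝ)) - 1 - I * (t * x : ℝ)) / (x : ℂ) ^ 2
        = (Complex.exp (I * (t * x : ℝ)) - 1 - I * (t * x : ℝ)) * ((1 / x ^ 2 : ℝ) : ℂ) := by
      push_cast; ring
    rw [h2, Complex.add_re, Complex.re_mul_ofReal]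
    have h3 : (0 : ℝ) ≤ 1 / x ^ 2 := by positivity
    simp only [Complex.sub_re, Complex.one_re, Complex.mul_re, Complex.I_re, Complex.I_im,
      Complex.ofReal_re, Complex.ofReal_im]
    nlinarith

lemma continuous_levyKernel_left (x : ℝ) : Continuous fun t : ℝ => levyKernel t x := by
  rcases eq_or_ne x 0 with rfl | hx
  · simp only [levyKernel_zero]
    fun_prop
  · simp only [levyKernel_of_ne hx]
    fun_prop

lemma norm_exp_sub_taylor_two_le {u : ℝ} (hu : |u| ≤ 1) :
    ‖Complex.exp (I * u) - 1 - I * u + (u : ℂ) ^ 2 / 2‖ ≤ |u| ^ 3 := by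
  have h0 : ‖I * (u : ℂ)‖ = |u| := by simp
  have h := Complex.exp_bound (x := I * u) (by rw [h0]; exact hu) (n := 3) (by norm_num)
  rw [h0] at h
  have h1 : ∑ m ∈ Finset.range 3, (I * (u : ℂ)) ^ m / (m.factorial : ℂ)
      = 1 + I * u - (u : ℂ) ^ 2 / 2 := by
    simp [Finset.sum_range_succ, Nat.factorial, mul_pow]
    ring
  rw [h1] at h
  refine le_trans (le_of_eq (by congr 1; ring)) (h.trans ?_)
  norm_num [Nat.factorial]
  nlinarith [pow_nonneg (abs_nonneg u) 3]

lemma continuous_levyKernel_right (t : ℝ) : Continuous fun x : ℝ => levyKernel t x := by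
  rw [continuous_iff_continuousAt]
  intro x
  rcases eq_or_ne x 0 with rfl | hx
  · have hev : ∀ᶠ x : ℝ in 𝓝 0, ‖levyKernel t x - levyKernel t 0‖
        ≤ |t * x| + |t| ^ 3 * |x| := by
      have h1 : ∀ᶠ x : ℝ in 𝓝 0, |t * x| < 1 :=
        Continuous.tendsto' (f := fun x : ℝ => |t * x|) (by fun_prop) 0 0 (by simp)
          |>.eventually_lt_const one_pos
      filter_upwards [h1] with x h1
      rcases eq_or_ne x 0 with rfl | hx
      · simp
      have h2 : (x : ℂ) ≠ 0 := by exact_mod_cast hx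
      have h3 : levyKernel t x - levyKernel t 0 = (Complex.exp (I * (t * x : ℝ)) - 1)
          + (Complex.exp (I * (t * x : ℝ)) - 1 - I * (t * x : ℝ) + ((t * x : ℝ) : ℂ) ^ 2 / 2)
            / (x : ℂ) ^ 2 := by
        rw [levyKernel_of_ne hx, levyKernel_zero]
        push_cast
        field_simp
        ring
      rw [h3]
      refine (norm_add_le _ _).trans (add_le_add ?_ ?_)
      · simpa using Real.norm_exp_I_mul_ofReal_sub_one_le (x := t * x)
      · have hx2 : 0 < |x| ^ 2 := by positivity
        rw [norm_div, norm_pow, Complex.norm_real, Real.norm_eq_abs, div_le_iff₀ hx2]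
        refine (norm_exp_sub_taylor_two_le h1.le).trans (le_of_eq ?_)
        rw [abs_mul]
        ring
    rw [ContinuousAt, tendsto_iff_norm_sub_tendsto_zero]
    refine squeeze_zero' (Eventually.of_forall fun _ => norm_nonneg _) hev ?_
    exact Continuous.tendsto' (by fun_prop) _ _ (by simp)
  · have h2 : (x : ℂ) ≠ 0 := by exact_mod_cast hx
    have h : ContinuousAt (fun x : ℝ => (Complex.exp (I * (t * x : ℝ)) - 1)
      + (Complex.exp (I * (t * x : ℝ)) - 1 - I * (t * x : ℝ)) / (x : ℂ) ^ 2) x := by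
      refine ContinuousAt.add (by fun_prop) (ContinuousAt.div (by fun_prop) (by fun_prop) ?_)
      exact pow_ne_zero 2 h2
    refine h.congr ?_
    filter_upwards [isOpen_ne.mem_nhds hx] with y hy
    rw [levyKernel_of_ne hy]

lemma measurable_levyKernel_uncurry : Measurable fun p : ℝ × ℝ => levyKernel p.1 p.2 := by
  unfold levyKernel
  refine Measurable.ite (measurableSet_eq_fun measurable_snd measurable_const) ?_ ?_ <;> fun_prop

/-- `levyKernel t` as a bounded continuous function. -/
def levyKernelBCF (t : ℝ) : BoundedContinuousFunction ℝ ℂ :=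
  BoundedContinuousFunction.ofNormedAddCommGroup (levyKernel t) (continuous_levyKernel_right t)
    (2 + 3 * t ^ 2) (norm_levyKernel_le t)

lemma integrable_levyKernel (σ : Measure ℝ) [IsFiniteMeasure σ] (t : ℝ) :
    Integrable (levyKernel t) σ :=
  Integrable.of_bound (continuous_levyKernel_right t).aestronglyMeasurable _
    (ae_of_all _ (norm_levyKernel_le t))

/-- The Lévy–Khintchine exponent of the pair `(γ, σ)`. -/
def levyExponent (γ : ℝ) (σ : Measure ℝ) (t : ℝ) : ℂ :=
  I * γ * t + ∫ x : ℝ, levyKernel t x ∂σ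

/-- The Nevanlinna function of the pair `(γ, σ)`. -/
def nevanlinna (γ : ℝ) (σ : Measure ℝ) (z : ℂ) : ℂ :=
  γ + ∫ x : ℝ, (1 + (x : ℂ) * z) / (z - (x : ℂ)) ∂σ

lemma levyExponent_zero (γ : ℝ) (σ : Measure ℝ) : levyExponent γ σ 0 = 0 := by
  have : ∀ x, levyKernel 0 x = 0 := by
    intro x
    simp [levyKernel]
  simp [levyExponent, this]

lemma norm_integral_levyKernel_le (σ : Measure ℝ) [IsFiniteMeasure σ] (t : ℝ) :
    ‖∫ x : ℝ, levyKernel t x ∂σ‖ ≤ (2 + 3 * t ^ 2) * σ.real Set.univ :=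
  norm_integral_le_of_norm_le_const (ae_of_all _ (norm_levyKernel_le t))

lemma norm_levyExponent_le (γ : ℝ) (σ : Measure ℝ) [IsFiniteMeasure σ] (t : ℝ) :
    ‖levyExponent γ σ t‖ ≤ |γ| * |t| + (2 + 3 * t ^ 2) * σ.real Set.univ := by
  refine (norm_add_le _ _).trans (add_le_add (le_of_eq ?_) (norm_integral_levyKernel_le σ t))
  simp

lemma re_levyExponent (γ : ℝ) (σ : Measure ℝ) (t : ℝ) :
    (levyExponent γ σ t).re = (∫ x : ℝ, levyKernel t x ∂σ).re := by
  simp [levyExponent]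

lemma re_levyExponent_nonpos (γ : ℝ) (σ : Measure ℝ) [IsFiniteMeasure σ] (t : ℝ) :
    (levyExponent γ σ t).re ≤ 0 := by
  rw [re_levyExponent]
  have h := integral_re (integrable_levyKernel σ t)
  simp only [RCLike.re_eq_complex_re] at h
  rw [← h]
  exact integral_nonpos fun x => re_levyKernel_nonpos t x

lemma continuous_levyExponent (γ : ℝ) (σ : Measure ℝ) [IsFiniteMeasure σ] :
    Continuous (levyExponent γ σ) := by
  refine Continuous.add (by fun_prop) ?_
  rw [continuous_iff_continuousAt]
  intro t₀
  refine continuousAt_of_dominated (bound := fun _ => 2 + 3 * (|t₀| + 1) ^ 2) ?_ ?_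
    (integrable_const _) ?_
  · exact Eventually.of_forall fun t => (continuous_levyKernel_right t).aestronglyMeasurable
  · filter_upwards [Metric.ball_mem_nhds t₀ one_pos] with t ht
    refine ae_of_all _ fun x => (norm_levyKernel_le t x).trans ?_
    have h1 : |t| ≤ |t₀| + 1 := by
      rw [Metric.mem_ball, Real.dist_eq] at ht
      have := abs_sub_abs_le_abs_sub t t₀
      linarith
    rw [← sq_abs t]
    gcongr
  · exact ae_of_all _ fun x => (continuous_levyKernel_left x).continuousAt

lemma tendsto_pow_mul_cexp_atTop_zero {a : ℂ} (ha : a.re < 0) (k : ℕ) :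
    Tendsto (fun t : ℝ => (t : ℂ) ^ k * Complex.exp (a * t)) atTop (𝓝 0) := by
  rw [tendsto_zero_iff_norm_tendsto_zero]
  have h := tendsto_rpow_mul_exp_neg_mul_atTop_nhds_zero (k : ℝ) (-a.re) (by linarith)
  refine h.congr' ?_
  filter_upwards [eventually_ge_atTop 0] with t ht
  rw [norm_mul, norm_pow, Complex.norm_exp, Complex.norm_real, Real.norm_eq_abs, abs_of_nonneg ht]
  simp

lemma integrableOn_pow_mul_cexp {a : ℂ} (ha : a.re < 0) (k : ℕ) :
    IntegrableOn (fun t : ℝ => (t : ℂ) ^ k * Complex.exp (a * t)) (Set.Ioi 0) := by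
  have h := integrableOn_rpow_mul_exp_neg_mul_rpow (s := k) (p := 1) (b := -a.re)
    (by have : (0 : ℝ) ≤ k := Nat.cast_nonneg k
        linarith) (by norm_num) (by linarith)
  refine Integrable.mono' h (Continuous.aestronglyMeasurable (by fun_prop)) ?_
  filter_upwards [ae_restrict_mem measurableSet_Ioi] with t ht
  have ht' : 0 < t := ht
  rw [norm_mul, norm_pow, Complex.norm_exp, Complex.norm_real, Real.norm_eq_abs, abs_of_pos ht']
  simp

lemma hasDerivAt_cexp_mul (a : ℂ) (t : ℝ) :
    HasDerivAt (fun t : ℝ => Complex.exp (a * t)) (a * Complex.exp (a * t)) t := by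
  have h : HasDerivAt (fun t : ℝ => a * (t : ℂ)) a t := by
    simpa using (Complex.ofRealCLM.hasDerivAt (x := t)).const_mul a
  simpa [mul_comm] using h.cexp

lemma integral_cexp_mul {a : ℂ} (ha : a.re < 0) :
    ∫ t in Set.Ioi (0 : ℝ), Complex.exp (a * t) = -1 / a := by
  rw [integral_exp_mul_complex_Ioi ha]
  simp

lemma ne_zero_of_re_neg {a : ℂ} (ha : a.re < 0) : a ≠ 0 := by
  rintro rfl
  simp at ha

lemma integral_ofReal_mul_cexp_mul {a : ℂ} (ha : a.re < 0) :
    ∫ t in Set.Ioi (0 : ℝ), (t : ℂ) * Complex.exp (a * t) = 1 / a ^ 2 := by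
  have ha0 := ne_zero_of_re_neg ha
  have hd : ∀ t ∈ Set.Ici (0 : ℝ), HasDerivAt
      (fun t : ℝ => ((t : ℂ) / a - 1 / a ^ 2) * Complex.exp (a * t))
      ((t : ℂ) * Complex.exp (a * t)) t := by
    intro t _
    have h1 : HasDerivAt (fun t : ℝ => (t : ℂ) / a - 1 / a ^ 2) (1 / a) t := by
      simpa using ((Complex.ofRealCLM.hasDerivAt (x := t)).div_const a).sub_const (1 / a ^ 2)
    convert! h1.mul (hasDerivAt_cexp_mul a t) using 1
    field_simp
    ring
  have ht : Tendsto (fun t : ℝ => ((t : ℂ) / a - 1 / a ^ 2) * Complex.exp (a * t)) atTop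
      (𝓝 0) := by
    have h := ((tendsto_pow_mul_cexp_atTop_zero ha 1).div_const a).sub
      ((tendsto_pow_mul_cexp_atTop_zero ha 0).div_const (a ^ 2))
    simp only [zero_div, sub_zero] at h
    refine h.congr fun t => ?_
    ring
  rw [integral_Ioi_of_hasDerivAt_of_tendsto' hd
    (by simpa using integrableOn_pow_mul_cexp ha 1) ht]
  simp

lemma integral_ofReal_sq_mul_cexp_mul {a : ℂ} (ha : a.re < 0) :
    ∫ t in Set.Ioi (0 : ℝ), (t : ℂ) ^ 2 * Complex.exp (a * t) = -2 / a ^ 3 := by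
  have ha0 := ne_zero_of_re_neg ha
  have hd : ∀ t ∈ Set.Ici (0 : ℝ), HasDerivAt
      (fun t : ℝ => ((t : ℂ) ^ 2 / a - 2 * (t : ℂ) / a ^ 2 + 2 / a ^ 3) * Complex.exp (a * t))
      ((t : ℂ) ^ 2 * Complex.exp (a * t)) t := by
    intro t _
    have h0 := Complex.ofRealCLM.hasDerivAt (x := t)
    have h1 : HasDerivAt (fun t : ℝ => (t : ℂ) ^ 2 / a - 2 * (t : ℂ) / a ^ 2 + 2 / a ^ 3)
        (2 * t / a - 2 / a ^ 2) t := by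
      simpa using (((h0.pow 2).div_const a).sub ((h0.const_mul 2).div_const (a ^ 2))).add_const
        (2 / a ^ 3)
    convert! h1.mul (hasDerivAt_cexp_mul a t) using 1
    field_simp
    ring
  have ht : Tendsto (fun t : ℝ => ((t : ℂ) ^ 2 / a - 2 * (t : ℂ) / a ^ 2 + 2 / a ^ 3)
      * Complex.exp (a * t)) atTop (𝓝 0) := by
    have h := (((tendsto_pow_mul_cexp_atTop_zero ha 2).div_const a).sub
      (((tendsto_pow_mul_cexp_atTop_zero ha 1).const_mul 2).div_const (a ^ 2))).add
      (((tendsto_pow_mul_cexp_atTop_zero ha 0).const_mul 2).div_const (a ^ 3))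
    simp only [mul_zero, zero_div, sub_zero, add_zero] at h
    refine h.congr fun t => ?_
    ring
  rw [integral_Ioi_of_hasDerivAt_of_tendsto' hd (integrableOn_pow_mul_cexp ha 2) ht]
  simp [neg_div]

lemma integral_cexp_mul_levyKernel {z : ℂ} (hz : 0 < z.im) (x : ℝ) :
    ∫ t in Set.Ioi (0 : ℝ), Complex.exp (I * z * t) * levyKernel (-t) x
      = I / z ^ 2 * ((1 + x * z) / (z - x)) := by
  have ha : (I * z).re < 0 := by simpa using hz
  have hz0 : z ≠ 0 := by
    rintro rfl
    simp at hz
  rcases eq_or_ne x 0 with rfl | hx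
  · have : ∀ t : ℝ, Complex.exp (I * z * t) * levyKernel (-t) 0
        = (-1 / 2) * ((t : ℂ) ^ 2 * Complex.exp (I * z * t)) := by
      intro t
      rw [levyKernel_zero]
      push_cast
      ring
    simp_rw [this]
    rw [integral_const_mul, integral_ofReal_sq_mul_cexp_mul ha, mul_pow]
    have : I ^ 3 = -I := by rw [pow_succ, I_sq]; ring
    rw [this]
    simp only [ofReal_zero, zero_mul, add_zero, sub_zero]
    field_simp
    simp
  · have hx0 : (x : ℂ) ≠ 0 := by exact_mod_cast hx
    have hzx : z - x ≠ 0 := sub_ofReal_ne_zero hz.ne' x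
    have hb : (I * (z - x)).re < 0 := by simpa using hz
    have hfun : ∀ t : ℝ, Complex.exp (I * z * t) * levyKernel (-t) x
        = (1 + 1 / (x : ℂ) ^ 2) * Complex.exp (I * (z - x) * t)
          - (1 + 1 / (x : ℂ) ^ 2) * Complex.exp (I * z * t)
          + I / x * ((t : ℂ) * Complex.exp (I * z * t)) := by
      intro t
      have he : Complex.exp (I * (z - x) * t)
          = Complex.exp (I * z * t) * Complex.exp (I * (-t * x : ℝ)) := by
        rw [← Complex.exp_add]
        push_cast
        ring_nf
      rw [levyKernel_of_ne hx, he]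
      push_cast
      field_simp
      ring
    simp_rw [hfun]
    have i1 : IntegrableOn (fun t : ℝ => Complex.exp (I * (z - x) * t)) (Set.Ioi 0) := by
      simpa using integrableOn_pow_mul_cexp hb 0
    have i2 : IntegrableOn (fun t : ℝ => Complex.exp (I * z * t)) (Set.Ioi 0) := by
      simpa using integrableOn_pow_mul_cexp ha 0
    have i3 : IntegrableOn (fun t : ℝ => (t : ℂ) * Complex.exp (I * z * t)) (Set.Ioi 0) := by
      simpa using integrableOn_pow_mul_cexp ha 1
    have i12 : IntegrableOn (fun t : ℝ => (1 + 1 / (x : ℂ) ^ 2) * Complex.exp (I * (z - x) * t)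
        - (1 + 1 / (x : ℂ) ^ 2) * Complex.exp (I * z * t)) (Set.Ioi 0) :=
      (i1.const_mul _).sub (i2.const_mul _)
    rw [integral_add i12 (i3.const_mul _),
      integral_sub (i1.const_mul _) (i2.const_mul _), integral_const_mul, integral_const_mul,
      integral_const_mul, integral_cexp_mul hb, integral_cexp_mul ha,
      integral_ofReal_mul_cexp_mul ha]
    field_simp
    simp only [I_sq]
    ring

lemma norm_cexp_I_mul_mul (z : ℂ) (t : ℝ) : ‖Complex.exp (I * z * t)‖ = Real.exp (-z.im * t) := by
  rw [Complex.norm_exp]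
  simp

lemma integrableOn_exp_mul_add_sq {b : ℝ} (hb : 0 < b) (A B C : ℝ) :
    IntegrableOn (fun t : ℝ => Real.exp (-b * t) * (A * |t| + (B + C * t ^ 2))) (Set.Ioi 0) := by
  have h : ∀ k : ℕ, IntegrableOn (fun t : ℝ => t ^ k * Real.exp (-b * t)) (Set.Ioi 0) := by
    intro k
    have h := integrableOn_rpow_mul_exp_neg_mul_rpow (s := k) (p := 1) (b := b)
      (by have : (0 : ℝ) ≤ k := Nat.cast_nonneg k
          linarith) (by norm_num) hb
    simpa using h
  have := (((h 1).const_mul A).add (((h 0).const_mul B).add ((h 2).const_mul C)))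
  refine IntegrableOn.congr_fun this (fun t ht => ?_) measurableSet_Ioi
  have ht' : 0 < t := ht
  simp only [Pi.add_apply, abs_of_pos ht']
  ring

lemma integral_cexp_mul_levyExponent {z : ℂ} (hz : 0 < z.im) (γ : ℝ) (σ : Measure ℝ)
    [IsFiniteMeasure σ] :
    ∫ t in Set.Ioi (0 : ℝ), Complex.exp (I * z * t) * levyExponent γ σ (-t)
      = I / z ^ 2 * nevanlinna γ σ z := by
  have ha : (I * z).re < 0 := by simpa using hz
  have hz0 : z ≠ 0 := by
    rintro rfl
    simp at hz
  have hdom : ∀ p : ℝ × ℝ, ‖Complex.exp (I * z * p.1) * levyKernel (-p.1) p.2‖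
      ≤ Real.exp (-z.im * p.1) * (0 * |p.1| + (2 + 3 * p.1 ^ 2)) := by
    intro p
    rw [norm_mul, norm_cexp_I_mul_mul]
    gcongr
    refine (norm_levyKernel_le _ _).trans (le_of_eq (by ring))
  have hmeas : Measurable fun p : ℝ × ℝ => Complex.exp (I * z * p.1) * levyKernel (-p.1) p.2 := by
    refine Measurable.mul (by fun_prop) ?_
    exact measurable_levyKernel_uncurry.comp (measurable_fst.neg.prodMk measurable_snd)
  have hInt : Integrable (Function.uncurry fun t x : ℝ =>
      Complex.exp (I * z * t) * levyKernel (-t) x)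
      ((volume.restrict (Set.Ioi 0)).prod σ) := by
    refine Integrable.mono' ((integrableOn_exp_mul_add_sq hz 0 2 3).comp_fst σ)
      hmeas.aestronglyMeasurable (ae_of_all _ hdom)
  have hsplit : ∀ t : ℝ, Complex.exp (I * z * t) * levyExponent γ σ (-t)
      = (-I * γ) * ((t : ℂ) * Complex.exp (I * z * t))
        + ∫ x, Complex.exp (I * z * t) * levyKernel (-t) x ∂σ := by
    intro t
    rw [levyExponent, integral_const_mul]
    push_cast
    ring
  simp_rw [hsplit]
  have i3 : IntegrableOn (fun t : ℝ => (t : ℂ) * Complex.exp (I * z * t)) (Set.Ioi 0) := by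
    simpa using integrableOn_pow_mul_cexp ha 1
  have i4 : IntegrableOn (fun t : ℝ => ∫ x, Complex.exp (I * z * t) * levyKernel (-t) x ∂σ)
      (Set.Ioi 0) := hInt.integral_prod_left
  rw [integral_add (i3.const_mul _) i4, integral_const_mul,
    integral_ofReal_mul_cexp_mul ha, integral_integral_swap hInt]
  simp_rw [integral_cexp_mul_levyKernel hz]
  rw [integral_const_mul, nevanlinna, mul_pow, I_sq]
  field_simp

lemma nevanlinna_eq_integral {z : ℂ} (hz : 0 < z.im) (γ : ℝ) (σ : Measure ℝ)
    [IsFiniteMeasure σ] :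
    nevanlinna γ σ z = -I * z ^ 2 *
      ∫ t in Set.Ioi (0 : ℝ), Complex.exp (I * z * t) * levyExponent γ σ (-t) := by
  have hz0 : z ≠ 0 := by
    rintro rfl
    simp at hz
  rw [integral_cexp_mul_levyExponent hz]
  field_simp
  simp

lemma norm_cexp_mul_levyExponent_le (z : ℂ) (γ : ℝ) (σ : Measure ℝ) [IsFiniteMeasure σ]
    {A B : ℝ} (hA : |γ| ≤ A) (hB : σ.real Set.univ ≤ B) (t : ℝ) :
    ‖Complex.exp (I * z * t) * levyExponent γ σ (-t)‖
      ≤ Real.exp (-z.im * t) * (A * |t| + (2 * B + 3 * B * t ^ 2)) := by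
  rw [norm_mul, norm_cexp_I_mul_mul]
  gcongr
  refine (norm_levyExponent_le γ σ (-t)).trans ?_
  rw [abs_neg, neg_sq]
  have : (2 + 3 * t ^ 2) * σ.real Set.univ ≤ (2 + 3 * t ^ 2) * B := by gcongr
  nlinarith [mul_le_mul_of_nonneg_right hA (abs_nonneg t)]

/-- Pointwise convergence of Lévy exponents with bounded parameters implies pointwise convergence
of the Nevanlinna functions. -/
lemma tendsto_nevanlinna_of_tendsto_levyExponent {γ : ℕ → ℝ} {σ : ℕ → Measure ℝ}
    [∀ n, IsFiniteMeasure (σ n)] {γ₀ : ℝ} {σ₀ : Measure ℝ} [IsFiniteMeasure σ₀] {A B : ℝ}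
    (hA : ∀ᶠ n in atTop, |γ n| ≤ A) (hB : ∀ᶠ n in atTop, (σ n).real Set.univ ≤ B)
    (h : ∀ t, Tendsto (fun n => levyExponent (γ n) (σ n) t) atTop (𝓝 (levyExponent γ₀ σ₀ t)))
    {z : ℂ} (hz : 0 < z.im) :
    Tendsto (fun n => nevanlinna (γ n) (σ n) z) atTop (𝓝 (nevanlinna γ₀ σ₀ z)) := by
  simp_rw [nevanlinna_eq_integral hz]
  refine Tendsto.const_mul _ ?_
  refine tendsto_integral_filter_of_dominated_convergence
    (fun t => Real.exp (-z.im * t) * (A * |t| + (2 * B + 3 * B * t ^ 2))) ?_ ?_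
    (integrableOn_exp_mul_add_sq hz _ _ _) ?_
  · refine Eventually.of_forall fun n => Continuous.aestronglyMeasurable ?_
    have := continuous_levyExponent (γ n) (σ n)
    fun_prop
  · filter_upwards [hA, hB] with n hAn hBn
    exact ae_of_all _ (norm_cexp_mul_levyExponent_le z _ _ hAn hBn)
  · exact ae_of_all _ fun t => (h (-t)).const_mul _

lemma nevanlinna_I (γ : ℝ) (σ : Measure ℝ) : nevanlinna γ σ I = γ - I * σ.real Set.univ := by
  have h : ∀ x : ℝ, (1 + (x : ℂ) * I) / (I - x) = -I := by
    intro x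
    have : I - (x : ℂ) ≠ 0 := sub_ofReal_ne_zero (by simp) x
    rw [div_eq_iff this]
    ring_nf
    simp
    ring
  simp_rw [nevanlinna, h]
  simp
  ring

lemma nevanlinna_eq_cauchyT {z : ℂ} (hz : 0 < z.im) (γ : ℝ) (σ : Measure ℝ)
    [IsFiniteMeasure σ] :
    nevanlinna γ σ z = γ + (1 + z ^ 2) * cauchyT σ z - z * σ.real Set.univ := by
  have h : ∀ x : ℝ, (1 + (x : ℂ) * z) / (z - x) = (1 + z ^ 2) * (z - (x : ℂ))⁻¹ - z := by
    intro x
    have : z - (x : ℂ) ≠ 0 := sub_ofReal_ne_zero hz.ne' x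
    field_simp
    ring
  simp_rw [nevanlinna, h]
  rw [integral_sub ((integrable_resolvent σ hz.ne').const_mul _) (integrable_const _),
    integral_const_mul, cauchyT]
  simp
  ring

/-- Pointwise convergence of Nevanlinna functions implies pointwise convergence of the Lévy
exponents. -/
lemma tendsto_levyExponent_of_tendsto_nevanlinna {γ : ℕ → ℝ} {σ : ℕ → Measure ℝ}
    [∀ n, IsFiniteMeasure (σ n)] {γ₀ : ℝ} {σ₀ : Measure ℝ} [IsFiniteMeasure σ₀]
    (h : ∀ z : ℂ, 0 < z.im →
      Tendsto (fun n => nevanlinna (γ n) (σ n) z) atTop (𝓝 (nevanlinna γ₀ σ₀ z))) (t : ℝ) :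
    Tendsto (fun n => levyExponent (γ n) (σ n) t) atTop (𝓝 (levyExponent γ₀ σ₀ t)) := by
  have hI := h I (by simp)
  simp_rw [nevanlinna_I] at hI
  have hγ : Tendsto γ atTop (𝓝 γ₀) := by
    have := (Complex.continuous_re.tendsto _).comp hI
    simpa [Function.comp_def] using this
  have hσ : Tendsto (fun n => (σ n).real Set.univ) atTop (𝓝 (σ₀.real Set.univ)) := by
    have := (Complex.continuous_im.tendsto _).comp hI
    simpa [Function.comp_def] using this.neg
  have hγ' : Tendsto (fun n => (γ n : ℂ)) atTop (𝓝 (γ₀ : ℂ)) :=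
    (Complex.continuous_ofReal.tendsto _).comp hγ
  have hσ' : Tendsto (fun n => ((σ n).real Set.univ : ℂ)) atTop (𝓝 (σ₀.real Set.univ : ℂ)) :=
    (Complex.continuous_ofReal.tendsto _).comp hσ
  refine Tendsto.add ((hγ'.const_mul I).mul_const _) ?_
  refine tendsto_integral_of_tendsto_mass_of_tendsto_cauchyT hσ (fun z hz => ?_)
    (levyKernelBCF t)
  have hz0 : 0 < z.im := by linarith
  have hne : 1 + z ^ 2 ≠ 0 := by
    have : 1 + z ^ 2 = (z - I) * (z + I) := by ring_nf; simp; ring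
    rw [this]
    refine mul_ne_zero ?_ ?_ <;> intro h0 <;> have := congrArg Complex.im h0 <;>
      simp at this <;> linarith
  have key : ∀ (g : ℝ) (s : Measure ℝ) [IsFiniteMeasure s],
      cauchyT s z = (nevanlinna g s z - g + z * s.real Set.univ) / (1 + z ^ 2) := by
    intro g s _
    rw [nevanlinna_eq_cauchyT hz0]
    field_simp
    ring
  rw [key γ₀ σ₀]
  refine Tendsto.congr (fun n => (key (γ n) (σ n)).symm) ?_
  exact (((h z hz0).sub hγ').add (hσ'.const_mul z)).div_const _

lemma continuous_sq_div : Continuous fun x : ℝ => x ^ 2 / (1 + x ^ 2) :=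
  Continuous.div (by fun_prop) (by fun_prop) fun x => by positivity

lemma continuous_div_one_add_sq : Continuous fun x : ℝ => x / (1 + x ^ 2) :=
  Continuous.div (by fun_prop) (by fun_prop) fun x => by positivity

lemma sq_div_nonneg (x : ℝ) : 0 ≤ x ^ 2 / (1 + x ^ 2) := by positivity

lemma sq_div_le_one (x : ℝ) : x ^ 2 / (1 + x ^ 2) ≤ 1 := by
  rw [div_le_one (by positivity)]
  linarith

lemma abs_div_one_add_sq_le (x : ℝ) : |x / (1 + x ^ 2)| ≤ 1 / 2 := by
  have h : (0 : ℝ) < 1 + x ^ 2 := by positivity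
  rw [abs_div, abs_of_pos h, div_le_iff₀ h, ← sq_abs x]
  nlinarith [sq_nonneg (|x| - 1)]

lemma integrable_sq_div (μ : Measure ℝ) [IsFiniteMeasure μ] :
    Integrable (fun x : ℝ => x ^ 2 / (1 + x ^ 2)) μ :=
  Integrable.of_bound continuous_sq_div.aestronglyMeasurable 1 (ae_of_all _ fun x => by
    rw [Real.norm_eq_abs, abs_of_nonneg (sq_div_nonneg x)]
    exact sq_div_le_one x)

lemma integrable_div_one_add_sq (μ : Measure ℝ) [IsFiniteMeasure μ] :
    Integrable (fun x : ℝ => x / (1 + x ^ 2)) μ :=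
  Integrable.of_bound continuous_div_one_add_sq.aestronglyMeasurable (1 / 2)
    (ae_of_all _ abs_div_one_add_sq_le)

instance isProbabilityMeasure_centerR (ν : Measure ℝ) [IsProbabilityMeasure ν] :
    IsProbabilityMeasure (centerR ν) :=
  Measure.isProbabilityMeasure_map (by fun_prop)

/-- The finite measure `x² / (1 + x²) dν°(x)`. -/
def canonicalMeasure (ν : Measure ℝ) : Measure ℝ :=
  (centerR ν).withDensity fun x => ENNReal.ofReal (x ^ 2 / (1 + x ^ 2))

/-- The drift `∫ x / (1 + x²) dν°(x)`. -/
def centeredDrift (ν : Measure ℝ) : ℝ := ∫ x, x / (1 + x ^ 2) ∂(centerR ν)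

instance isFiniteMeasure_canonicalMeasure (ν : Measure ℝ) [IsProbabilityMeasure ν] :
    IsFiniteMeasure (canonicalMeasure ν) :=
  isFiniteMeasure_withDensity_ofReal (integrable_sq_div _).2

lemma integral_canonicalMeasure (ν : Measure ℝ) (f : ℝ → ℂ) :
    ∫ x, f x ∂(canonicalMeasure ν)
      = ∫ x, f x * ((x ^ 2 / (1 + x ^ 2) : ℝ) : ℂ) ∂(centerR ν) := by
  rw [canonicalMeasure, integral_withDensity_eq_integral_toReal_smul
    (continuous_sq_div.measurable.ennreal_ofReal) (by simp)]
  refine integral_congr_ae (ae_of_all _ fun x => ?_)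
  simp only [ENNReal.toReal_ofReal (sq_div_nonneg x), Complex.real_smul, mul_comm]

lemma canonicalMeasure_real_univ (ν : Measure ℝ) [IsProbabilityMeasure ν] :
    (canonicalMeasure ν).real Set.univ = ∫ x, x ^ 2 / (1 + x ^ 2) ∂(centerR ν) := by
  have h := integral_canonicalMeasure ν fun _ => 1
  simp only [one_mul, integral_const] at h
  rw [integral_complex_ofReal, Complex.real_smul, mul_one] at h
  exact_mod_cast h

lemma integral_centerR (ν : Measure ℝ) {E : Type*} [NormedAddCommGroup E] [NormedSpace ℝ E]
    {f : ℝ → E} (hf : Continuous f) :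
    ∫ x, f x ∂(centerR ν) = ∫ t, f (t - aR ν) ∂ν := by
  rw [centerR, integral_map (by fun_prop) hf.stronglyMeasurable.aestronglyMeasurable]

lemma abs_sub_indicator_le {a t : ℝ} (ha : |a| ≤ 1 / 2) :
    |(t - a) / (1 + (t - a) ^ 2) - Set.indicator {t : ℝ | |t| < 1} (fun t => t) t + a|
      ≤ 5 * ((t - a) ^ 2 / (1 + (t - a) ^ 2)) := by
  have hpos : (0 : ℝ) < 1 + (t - a) ^ 2 := by positivity
  by_cases ht : |t| < 1
  · rw [Set.indicator_of_mem (by exact ht)]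
    have h1 : (t - a) / (1 + (t - a) ^ 2) - t + a
        = -(t - a) * ((t - a) ^ 2 / (1 + (t - a) ^ 2)) := by
      field_simp
      ring
    rw [h1, abs_mul, abs_of_nonneg (sq_div_nonneg (t - a)), abs_neg]
    have h2 : |t - a| ≤ 5 := by
      have := abs_sub t a
      linarith
    exact mul_le_mul_of_nonneg_right h2 (sq_div_nonneg _)
  · rw [Set.indicator_of_notMem (by exact ht)]
    have h1 : |(t - a) / (1 + (t - a) ^ 2) - 0 + a| ≤ 1 := by
      refine (abs_add_le _ _).trans ?_
      have := abs_div_one_add_sq_le (t - a)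
      rw [sub_zero]
      linarith
    refine h1.trans ?_
    have h2 : 1 / 2 ≤ |t - a| := by
      have := abs_sub_abs_le_abs_sub t a
      linarith [not_lt.1 ht]
    have h3 : 1 / 4 ≤ (t - a) ^ 2 := by
      rw [← sq_abs]
      nlinarith
    rw [← mul_div_assoc, le_div_iff₀ hpos]
    linarith

lemma abs_centeredDrift_le (ν : Measure ℝ) [IsProbabilityMeasure ν] (ha : |aR ν| ≤ 1 / 2) :
    |centeredDrift ν| ≤ 5 * (canonicalMeasure ν).real Set.univ := by
  have hms : MeasurableSet {t : ℝ | |t| < 1} := measurableSet_lt (by fun_prop) (by fun_prop)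
  have hind : Integrable (Set.indicator {t : ℝ | |t| < 1} fun t => t) ν := by
    refine Integrable.of_bound (measurable_id.indicator hms).aestronglyMeasurable 1
      (ae_of_all _ fun t => ?_)
    by_cases ht : |t| < 1
    · rw [Set.indicator_of_mem (by exact ht)]
      exact ht.le
    · rw [Set.indicator_of_notMem (by exact ht)]
      simp
  have hshift : Measurable fun t : ℝ => t - aR ν := by fun_prop
  have i1 : Integrable (fun t : ℝ => (t - aR ν) / (1 + (t - aR ν) ^ 2)) ν :=
    (integrable_div_one_add_sq (centerR ν)).comp_measurable hshift
  have i2 : Integrable (fun t : ℝ => (t - aR ν) ^ 2 / (1 + (t - aR ν) ^ 2)) ν :=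
    (integrable_sq_div (centerR ν)).comp_measurable hshift
  have i3 : Integrable (fun t : ℝ => (t - aR ν) / (1 + (t - aR ν) ^ 2)
      - Set.indicator {t : ℝ | |t| < 1} (fun t => t) t) ν := i1.sub hind
  have h1 : centeredDrift ν = ∫ t, ((t - aR ν) / (1 + (t - aR ν) ^ 2)
      - Set.indicator {t : ℝ | |t| < 1} (fun t => t) t + aR ν) ∂ν := by
    rw [integral_add i3 (integrable_const _), integral_sub i1 hind,
      integral_indicator hms, centeredDrift, integral_centerR ν continuous_div_one_add_sq]
    simp [aR]
  rw [h1, canonicalMeasure_real_univ, integral_centerR ν continuous_sq_div, ← integral_const_mul,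
    ← Real.norm_eq_abs]
  exact norm_integral_le_of_norm_le (i2.const_mul 5)
    (ae_of_all _ fun t => abs_sub_indicator_le ha)

/-- The centred characteristic function minus one. -/
def centeredCharFun (ν : Measure ℝ) (t : ℝ) : ℂ :=
  ∫ x : ℝ, (Complex.exp (I * (t * x : ℝ)) - 1) ∂(centerR ν)

lemma integrable_exp_I_mul (μ : Measure ℝ) [IsFiniteMeasure μ] (t : ℝ) :
    Integrable (fun x : ℝ => Complex.exp (I * (t * x : ℝ))) μ :=
  Integrable.of_bound (Continuous.aestronglyMeasurable (by fun_prop)) 1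
    (ae_of_all _ fun x => by rw [Complex.norm_exp_I_mul_ofReal])

lemma integral_levyKernel_canonicalMeasure (ν : Measure ℝ) [IsProbabilityMeasure ν] (t : ℝ) :
    ∫ x, levyKernel t x ∂(canonicalMeasure ν)
      = centeredCharFun ν t - I * t * centeredDrift ν := by
  rw [integral_canonicalMeasure]
  simp_rw [levyKernel_mul]
  have i1 : Integrable (fun x : ℝ => Complex.exp (I * (t * x : ℝ)) - 1) (centerR ν) :=
    (integrable_exp_I_mul _ t).sub (integrable_const _)
  have i2 : Integrable (fun x : ℝ => ((x / (1 + x ^ 2) : ℝ) : ℂ)) (centerR ν) :=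
    (integrable_div_one_add_sq _).ofReal
  rw [integral_sub i1 (i2.const_mul _), integral_const_mul, integral_complex_ofReal,
    centeredCharFun,
    centeredDrift]

lemma levyExponent_canonical (ν : Measure ℝ) [IsProbabilityMeasure ν] (t : ℝ) :
    levyExponent (aR ν + centeredDrift ν) (canonicalMeasure ν) t
      = I * aR ν * t + centeredCharFun ν t := by
  rw [levyExponent, integral_levyKernel_canonicalMeasure]
  push_cast
  ring

lemma re_centeredCharFun_nonpos (ν : Measure ℝ) [IsProbabilityMeasure ν] (t : ℝ) :
    (centeredCharFun ν t).re ≤ 0 := by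
  have h := re_levyExponent_nonpos (aR ν + centeredDrift ν) (canonicalMeasure ν) t
  rw [levyExponent_canonical] at h
  simpa using h

lemma norm_centeredCharFun_le (ν : Measure ℝ) [IsProbabilityMeasure ν] (ha : |aR ν| ≤ 1 / 2)
    (t : ℝ) :
    ‖centeredCharFun ν t‖ ≤ (2 + 5 * |t| + 3 * t ^ 2) * (canonicalMeasure ν).real Set.univ := by
  have h : centeredCharFun ν t
      = I * t * centeredDrift ν + ∫ x, levyKernel t x ∂(canonicalMeasure ν) := by
    rw [integral_levyKernel_canonicalMeasure]
    ring
  rw [h]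
  refine (norm_add_le _ _).trans ?_
  have h1 := norm_integral_levyKernel_le (canonicalMeasure ν) t
  have h2 : ‖I * t * (centeredDrift ν : ℂ)‖ = |t| * |centeredDrift ν| := by simp
  rw [h2]
  have h3 := mul_le_mul_of_nonneg_left (abs_centeredDrift_le ν ha) (abs_nonneg t)
  linarith

lemma charFun_eq_exp_mul (ν : Measure ℝ) [IsProbabilityMeasure ν] (t : ℝ) :
    charFun ν t = Complex.exp (I * aR ν * t) * (1 + centeredCharFun ν t) := by
  rw [centeredCharFun, integral_sub (integrable_exp_I_mul _ t) (integrable_const _)]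
  simp only [integral_const, probReal_univ, one_smul, add_sub_cancel]
  rw [integral_centerR ν (by fun_prop), charFun_apply_real, ← integral_const_mul]
  refine integral_congr_ae (ae_of_all _ fun x => ?_)
  simp only
  rw [← Complex.exp_add]
  push_cast
  ring_nf

lemma nevanlinna_kernel_eq {z : ℂ} (hz : 0 < z.im) (x : ℝ) :
    (1 + (x : ℂ) * z) / (z - x) = (1 + z ^ 2) * (z - (x : ℂ))⁻¹ - z := by
  have : z - (x : ℂ) ≠ 0 := sub_ofReal_ne_zero hz.ne' x
  field_simp
  ring

lemma norm_nevanlinna_kernel_le {z : ℂ} (hz : 0 < z.im) (x : ℝ) :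
    ‖(1 + (x : ℂ) * z) / (z - x)‖ ≤ (1 + ‖z‖ ^ 2) / z.im + ‖z‖ := by
  rw [nevanlinna_kernel_eq hz]
  refine (norm_sub_le _ _).trans (add_le_add_left ?_ _)
  rw [norm_mul, div_eq_mul_inv]
  have h1 : ‖1 + z ^ 2‖ ≤ 1 + ‖z‖ ^ 2 := (norm_add_le _ _).trans (by simp)
  have h2 := norm_resolvent_le hz.ne' x
  rw [abs_of_pos hz] at h2
  exact mul_le_mul h1 h2 (norm_nonneg _) (by positivity)

lemma integrable_nevanlinna_kernel {z : ℂ} (hz : 0 < z.im) (σ : Measure ℝ) [IsFiniteMeasure σ] :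
    Integrable (fun x : ℝ => (1 + (x : ℂ) * z) / (z - x)) σ :=
  Integrable.of_bound (Continuous.aestronglyMeasurable
    (Continuous.div (by fun_prop) (by fun_prop) (sub_ofReal_ne_zero hz.ne'))) _
    (ae_of_all _ (norm_nevanlinna_kernel_le hz))

lemma integrable_mul_div_sub {z : ℂ} (hz : 0 < z.im) (μ : Measure ℝ) [IsFiniteMeasure μ] :
    Integrable (fun t : ℝ => (t : ℂ) * z / (z - t)) μ := by
  have h : ∀ t : ℝ, (t : ℂ) * z / (z - t) = z ^ 2 * (z - (t : ℂ))⁻¹ - z := by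
    intro t
    have : z - (t : ℂ) ≠ 0 := sub_ofReal_ne_zero hz.ne' t
    field_simp
    ring
  simp_rw [h]
  exact ((integrable_resolvent μ hz.ne').const_mul _).sub (integrable_const _)

lemma fR_eq {z : ℂ} (hz : 0 < z.im) (ν : Measure ℝ) [IsProbabilityMeasure ν] :
    fR ν z = centeredDrift ν
      + ∫ x : ℝ, (1 + (x : ℂ) * z) / (z - x) ∂(canonicalMeasure ν) := by
  have hpt : ∀ x : ℝ, (1 + (x : ℂ) * z) / (z - x) * ((x ^ 2 / (1 + x ^ 2) : ℝ) : ℂ)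
      = (x : ℂ) * z / (z - x) - ((x / (1 + x ^ 2) : ℝ) : ℂ) := by
    intro x
    have h1 : z - (x : ℂ) ≠ 0 := sub_ofReal_ne_zero hz.ne' x
    have h2 := one_add_ofReal_sq_ne_zero x
    push_cast
    field_simp
    ring
  have i2 : Integrable (fun x : ℝ => ((x / (1 + x ^ 2) : ℝ) : ℂ)) (centerR ν) :=
    (integrable_div_one_add_sq _).ofReal
  rw [integral_canonicalMeasure]
  simp_rw [hpt]
  rw [integral_sub (integrable_mul_div_sub hz _) i2, integral_complex_ofReal, fR, centeredDrift]
  ring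

lemma nevanlinna_canonical {z : ℂ} (hz : 0 < z.im) (ν : Measure ℝ) [IsProbabilityMeasure ν] :
    nevanlinna (aR ν + centeredDrift ν) (canonicalMeasure ν) z = aR ν + fR ν z := by
  rw [nevanlinna, fR_eq hz]
  push_cast
  ring

lemma norm_fR_le {z : ℂ} (hz : 0 < z.im) (ν : Measure ℝ) [IsProbabilityMeasure ν]
    (ha : |aR ν| ≤ 1 / 2) :
    ‖fR ν z‖ ≤ (5 + (1 + ‖z‖ ^ 2) / z.im + ‖z‖) * (canonicalMeasure ν).real Set.univ := by
  rw [fR_eq hz]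
  refine (norm_add_le _ _).trans ?_
  have h1 : ‖∫ x : ℝ, (1 + (x : ℂ) * z) / (z - x) ∂(canonicalMeasure ν)‖
      ≤ ((1 + ‖z‖ ^ 2) / z.im + ‖z‖) * (canonicalMeasure ν).real Set.univ :=
    norm_integral_le_of_norm_le_const (ae_of_all _ (norm_nevanlinna_kernel_le hz))
  have h2 := abs_centeredDrift_le ν ha
  rw [Complex.norm_real, Real.norm_eq_abs]
  linarith

lemma one_add_abs_le {w : ℂ} (hw : 0 < w.im) (x : ℝ) :
    1 + |x| ≤ (1 + (1 + ‖w‖) / w.im) * ‖w - x‖ := by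
  have h1 : |x| ≤ ‖w - x‖ + ‖w‖ := by
    have := norm_sub_norm_le (x : ℂ) w
    rw [norm_sub_rev, Complex.norm_real, Real.norm_eq_abs] at this
    linarith
  have h2 : w.im ≤ ‖w - x‖ := by
    simpa [abs_of_pos hw] using abs_im_le_norm_sub_ofReal w x
  have h3 : 1 + ‖w‖ ≤ (1 + ‖w‖) / w.im * ‖w - x‖ := by
    rw [div_mul_eq_mul_div, le_div_iff₀ hw]
    gcongr
  linarith

lemma norm_fR_sub_fR_le {z w : ℂ} (hz : 0 < z.im) (hw : 0 < w.im) (ν : Measure ℝ)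
    [IsProbabilityMeasure ν] :
    ‖fR ν w - fR ν z‖ ≤ ‖z - w‖ * ((1 + (1 + ‖w‖) / w.im) * (1 + (1 + ‖z‖) / z.im))
      * (canonicalMeasure ν).real Set.univ := by
  rw [fR, fR, ← integral_sub (integrable_mul_div_sub hw _) (integrable_mul_div_sub hz _),
    canonicalMeasure_real_univ, ← integral_const_mul]
  refine norm_integral_le_of_norm_le ((integrable_sq_div _).const_mul _) (ae_of_all _ fun x => ?_)
  have hz0 : z - (x : ℂ) ≠ 0 := sub_ofReal_ne_zero hz.ne' x
  have hw0 : w - (x : ℂ) ≠ 0 := sub_ofReal_ne_zero hw.ne' x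
  have h1 : (x : ℂ) * w / (w - x) - (x : ℂ) * z / (z - x)
      = (z - w) * ((x : ℂ) ^ 2 / ((w - x) * (z - x))) := by
    field_simp
    ring
  rw [h1, norm_mul, mul_assoc]
  refine mul_le_mul_of_nonneg_left ?_ (norm_nonneg _)
  rw [norm_div, norm_pow, Complex.norm_real, Real.norm_eq_abs, sq_abs, norm_mul,
    ← mul_div_assoc, div_le_div_iff₀ (by positivity) (by positivity)]
  have h2 := mul_le_mul (one_add_abs_le hw x) (one_add_abs_le hz x) (by positivity)
    (by positivity)
  have h3 : 1 + x ^ 2 ≤ (1 + |x|) * (1 + |x|) := by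
    nlinarith [abs_nonneg x, sq_abs x]
  have h4 := mul_le_mul_of_nonneg_left (h3.trans h2) (sq_nonneg x)
  calc x ^ 2 * (1 + x ^ 2) ≤ _ := h4
    _ = _ := by ring

lemma cauchyT_eq_fR {z : ℂ} (hz : 0 < z.im) (ν : Measure ℝ) [IsProbabilityMeasure ν] :
    cauchyT ν z = ((z - aR ν) + fR ν (z - aR ν)) / (z - aR ν) ^ 2 := by
  set w : ℂ := z - aR ν with hw
  have hwim : 0 < w.im := by simpa [hw] using hz
  have hw0 : w ≠ 0 := by
    rintro h
    simp [h] at hwim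
  have h1 : cauchyT ν z = ∫ x : ℝ, (w - (x : ℂ))⁻¹ ∂(centerR ν) := by
    rw [integral_centerR ν (continuous_resolvent hwim.ne'), cauchyT]
    refine integral_congr_ae (ae_of_all _ fun x => ?_)
    simp [hw]
  have h2 : ∀ x : ℝ, (w - (x : ℂ))⁻¹ = 1 / w + 1 / w ^ 2 * ((x : ℂ) * w / (w - x)) := by
    intro x
    have hx : w - (x : ℂ) ≠ 0 := sub_ofReal_ne_zero hwim.ne' x
    field_simp
    ring
  rw [h1]
  simp_rw [h2]
  rw [integral_add (integrable_const _) ((integrable_mul_div_sub hwim _).const_mul _),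
    integral_const_mul, ← fR]
  simp
  field_simp

lemma norm_ET_sub_le {z : ℂ} (hz : 0 < z.im) (ν : Measure ℝ) [IsProbabilityMeasure ν]
    (hf : ‖fR ν (z - aR ν)‖ ≤ z.im / 2) :
    ‖ET ν z - (aR ν + fR ν (z - aR ν))‖ ≤ 2 / z.im * ‖fR ν (z - aR ν)‖ ^ 2 := by
  rw [ET, cauchyT_eq_fR hz]
  set w : ℂ := z - aR ν with hw
  have hwim : w.im = z.im := by simp [hw]
  have hz' : z = aR ν + w := by simp [hw]
  have h1 : z.im ≤ ‖w‖ := by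
    rw [← hwim]
    exact (le_abs_self _).trans (Complex.abs_im_le_norm w)
  have h2 : z.im / 2 ≤ ‖w + fR ν w‖ := by
    have := norm_sub_le (w + fR ν w) (fR ν w)
    rw [add_sub_cancel_right] at this
    linarith
  have h3 : w + fR ν w ≠ 0 := by
    rw [← norm_pos_iff]
    linarith
  have hw0 : w ≠ 0 := by
    rw [← norm_pos_iff]
    linarith
  have h4 : z - ((w + fR ν w) / w ^ 2)⁻¹ - (aR ν + fR ν w) = -(fR ν w ^ 2 / (w + fR ν w)) := by
    rw [hz', inv_div]
    field_simp
    ring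
  rw [h4, norm_neg, norm_div, norm_pow, div_le_iff₀ (by linarith)]
  have h5 : 1 ≤ 2 / z.im * ‖w + fR ν w‖ := by
    rw [div_mul_eq_mul_div, le_div_iff₀ hz]
    linarith
  nlinarith [sq_nonneg ‖fR ν w‖]

lemma integrable_indicator_one_tail (ν : Measure ℝ) [IsFiniteMeasure ν] (δ : ℝ) :
    Integrable (Set.indicator {t : ℝ | δ ≤ |t|} fun _ => (1 : ℝ)) ν :=
  (integrable_const 1).indicator (measurableSet_le measurable_const (by fun_prop))

lemma integral_add_indicator_tail (ν : Measure ℝ) [IsProbabilityMeasure ν] (δ κ : ℝ) :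
    ∫ t, (κ + Set.indicator {t : ℝ | δ ≤ |t|} (fun _ => (1 : ℝ)) t) ∂ν
      = κ + ν.real {t : ℝ | δ ≤ |t|} := by
  rw [integral_add (integrable_const _) (integrable_indicator_one_tail ν δ),
    integral_indicator_const _ (measurableSet_le measurable_const (by fun_prop))]
  simp

lemma abs_aR_le (ν : Measure ℝ) [IsProbabilityMeasure ν] {δ : ℝ} (hδ : 0 ≤ δ) :
    |aR ν| ≤ δ + ν.real {t : ℝ | δ ≤ |t|} := by
  have hms : MeasurableSet {t : ℝ | |t| < 1} := measurableSet_lt (by fun_prop) (by fun_prop)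
  rw [aR, ← integral_indicator hms, ← integral_add_indicator_tail, ← Real.norm_eq_abs]
  refine norm_integral_le_of_norm_le
    ((integrable_const _).add (integrable_indicator_one_tail ν δ)) (ae_of_all _ fun t => ?_)
  have h0 : 0 ≤ Set.indicator {t : ℝ | δ ≤ |t|} (fun _ => (1 : ℝ)) t :=
    Set.indicator_nonneg (fun _ _ => zero_le_one) t
  by_cases ht : |t| < 1
  · rw [Set.indicator_of_mem (by exact ht), Real.norm_eq_abs]
    rcases lt_or_ge |t| δ with h | h
    · linarith
    · rw [Set.indicator_of_mem (by exact h)]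
      linarith
  · rw [Set.indicator_of_notMem (by exact ht), norm_zero]
    linarith

lemma canonicalMeasure_real_univ_le (ν : Measure ℝ) [IsProbabilityMeasure ν] (δ : ℝ) :
    (canonicalMeasure ν).real Set.univ ≤ (δ + |aR ν|) ^ 2 + ν.real {t : ℝ | δ ≤ |t|} := by
  have hshift : Measurable fun t : ℝ => t - aR ν := by fun_prop
  rw [canonicalMeasure_real_univ, integral_centerR ν continuous_sq_div,
    ← integral_add_indicator_tail]
  refine integral_mono ((integrable_sq_div (centerR ν)).comp_measurable hshift)
    ((integrable_const _).add (integrable_indicator_one_tail ν δ)) fun t => ?_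
  simp only
  rcases lt_or_ge |t| δ with h | h
  · rw [Set.indicator_of_notMem (by simpa using h), add_zero]
    refine (div_le_self (sq_nonneg _) (by nlinarith [sq_nonneg (t - aR ν)])).trans ?_
    rw [← sq_abs (t - aR ν)]
    have := abs_sub t (aR ν)
    gcongr
    linarith
  · rw [Set.indicator_of_mem (by exact h)]
    have := sq_div_le_one (t - aR ν)
    nlinarith [sq_nonneg (δ + |aR ν|)]

lemma IsInfinitesimalArrayR.eventually_le {kn : ℕ → ℕ} {ν : ℕ → ℕ → Measure ℝ}
    (hprob : ∀ n i, IsProbabilityMeasure (ν n i)) (hinf : IsInfinitesimalArrayR kn ν)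
    {ε : ℝ} (hε : 0 < ε) :
    ∀ᶠ n in atTop, ∀ i < kn n,
      |aR (ν n i)| ≤ ε ∧ (canonicalMeasure (ν n i)).real Set.univ ≤ ε := by
  set δ : ℝ := min ε 1 / 4 with hδ
  have hδ0 : 0 < δ := by positivity
  have hδ1 : δ ≤ 1 / 4 := by
    have := min_le_right ε 1
    linarith
  have hδε : 4 * δ ≤ ε := by
    have := min_le_left ε 1
    linarith
  obtain ⟨N, hN⟩ := hinf δ hδ0 (ENNReal.ofReal δ) (by simpa using hδ0)
  filter_upwards [eventually_ge_atTop N] with n hn i hi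
  have htail : (ν n i).real {t : ℝ | δ ≤ |t|} ≤ δ :=
    ENNReal.toReal_le_of_le_ofReal hδ0.le (hN n hn i hi).le
  have ha := abs_aR_le (ν n i) hδ0.le
  have hs := canonicalMeasure_real_univ_le (ν n i) δ
  refine ⟨by linarith, ?_⟩
  have : (δ + |aR (ν n i)|) ^ 2 ≤ (3 * δ) ^ 2 := by
    have := abs_nonneg (aR (ν n i))
    gcongr
    linarith
  nlinarith

/-- The sum of the first `m` canonical measures. -/
def sumMeasure (ν : ℕ → Measure ℝ) (m : ℕ) : Measure ℝ :=
  ∑ i ∈ Finset.range m, canonicalMeasure (ν i)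

/-- The drift of the first `m` rows, translated by `c`. -/
def sumDrift (c : ℝ) (ν : ℕ → Measure ℝ) (m : ℕ) : ℝ :=
  c + ∑ i ∈ Finset.range m, (aR (ν i) + centeredDrift (ν i))

instance isFiniteMeasure_sumMeasure (ν : ℕ → Measure ℝ) [∀ i, IsProbabilityMeasure (ν i)]
    (m : ℕ) : IsFiniteMeasure (sumMeasure ν m) := by
  unfold sumMeasure
  infer_instance

lemma sumMeasure_real_univ (ν : ℕ → Measure ℝ) [∀ i, IsProbabilityMeasure (ν i)] (m : ℕ) :
    (sumMeasure ν m).real Set.univ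
      = ∑ i ∈ Finset.range m, (canonicalMeasure (ν i)).real Set.univ := by
  rw [sumMeasure, measureReal_def, Measure.finsetSum_apply, ENNReal.toReal_sum]
  · rfl
  · exact fun i _ => measure_ne_top _ _

lemma levyExponent_sum (c : ℝ) (ν : ℕ → Measure ℝ) [∀ i, IsProbabilityMeasure (ν i)] (m : ℕ)
    (t : ℝ) : levyExponent (sumDrift c ν m) (sumMeasure ν m) t
      = I * c * t + ∑ i ∈ Finset.range m, (I * aR (ν i) * t + centeredCharFun (ν i) t) := by
  simp_rw [← levyExponent_canonical, levyExponent, sumDrift, sumMeasure]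
  rw [integral_finsetSum_measure fun i _ => integrable_levyKernel _ t, Complex.ofReal_add,
    Complex.ofReal_sum, mul_add, add_mul, add_assoc, Finset.mul_sum, Finset.sum_mul,
    ← Finset.sum_add_distrib]

lemma nevanlinna_sum {z : ℂ} (hz : 0 < z.im) (c : ℝ) (ν : ℕ → Measure ℝ)
    [∀ i, IsProbabilityMeasure (ν i)] (m : ℕ) :
    nevanlinna (sumDrift c ν m) (sumMeasure ν m) z
      = c + ∑ i ∈ Finset.range m, (aR (ν i) + fR (ν i) z) := by
  simp_rw [← nevanlinna_canonical hz, nevanlinna, sumDrift, sumMeasure]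
  rw [integral_finsetSum_measure fun i _ => integrable_nevanlinna_kernel hz _,
    Complex.ofReal_add, Complex.ofReal_sum, add_assoc, ← Finset.sum_add_distrib]

instance isProbabilityMeasure_convSeq (ν : ℕ → Measure ℝ) [∀ i, IsProbabilityMeasure (ν i)]
    (m : ℕ) : IsProbabilityMeasure (convSeq ν m) := by
  induction m with
  | zero => exact Measure.dirac.isProbabilityMeasure
  | succ m ih =>
    rw [convSeq]
    infer_instance

lemma charFun_convSeq (ν : ℕ → Measure ℝ) [∀ i, IsProbabilityMeasure (ν i)] (m : ℕ) (t : ℝ) :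
    charFun (convSeq ν m) t = ∏ i ∈ Finset.range m, charFun (ν i) t := by
  induction m with
  | zero => simp [convSeq, charFun_dirac]
  | succ m ih => rw [convSeq, charFun_conv, ih, Finset.prod_range_succ]

lemma charFun_dirac_conv_convSeq (c : ℝ) (ν : ℕ → Measure ℝ) [∀ i, IsProbabilityMeasure (ν i)]
    (m : ℕ) (t : ℝ) :
    charFun (Measure.conv (Measure.dirac c) (convSeq ν m)) t
      = Complex.exp (I * c * t) * ∏ i ∈ Finset.range m,
        (Complex.exp (I * aR (ν i) * t) * (1 + centeredCharFun (ν i) t)) := by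
  rw [charFun_conv, charFun_convSeq, charFun_dirac]
  simp_rw [charFun_eq_exp_mul]
  congr 2
  simp
  ring

lemma norm_prod_sub_prod_le {u v : ℕ → ℂ} (hu : ∀ i, ‖u i‖ ≤ 1) (hv : ∀ i, ‖v i‖ ≤ 1) (m : ℕ) :
    ‖∏ i ∈ Finset.range m, u i - ∏ i ∈ Finset.range m, v i‖
      ≤ ∑ i ∈ Finset.range m, ‖u i - v i‖ := by
  induction m with
  | zero => simp
  | succ m ih =>
    rw [Finset.prod_range_succ, Finset.prod_range_succ, Finset.sum_range_succ]
    have h : (∏ i ∈ Finset.range m, u i) * u m - (∏ i ∈ Finset.range m, v i) * v m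
        = (∏ i ∈ Finset.range m, u i - ∏ i ∈ Finset.range m, v i) * u m
          + (∏ i ∈ Finset.range m, v i) * (u m - v m) := by ring
    have h1 : ‖∏ i ∈ Finset.range m, v i‖ ≤ 1 := by
      rw [norm_prod]
      exact Finset.prod_le_one (fun _ _ => norm_nonneg _) fun i _ => hv i
    rw [h]
    refine (norm_add_le _ _).trans (add_le_add ?_ ?_)
    · rw [norm_mul]
      exact (mul_le_of_le_one_right (norm_nonneg _) (hu m)).trans ih
    · rw [norm_mul]
      exact mul_le_of_le_one_left (norm_nonneg _) h1

lemma norm_exp_I_mul_mul_ofReal (a t : ℝ) : ‖Complex.exp (I * a * t)‖ = 1 := by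
  have : I * (a : ℂ) * t = I * (a * t : ℝ) := by push_cast; ring
  rw [this, Complex.norm_exp_I_mul_ofReal]

lemma exp_levyExponent_sum (c : ℝ) (ν : ℕ → Measure ℝ) [∀ i, IsProbabilityMeasure (ν i)] (m : ℕ)
    (t : ℝ) : Complex.exp (levyExponent (sumDrift c ν m) (sumMeasure ν m) t)
      = Complex.exp (I * c * t) * ∏ i ∈ Finset.range m,
        (Complex.exp (I * aR (ν i) * t) * Complex.exp (centeredCharFun (ν i) t)) := by
  rw [levyExponent_sum, Complex.exp_add, Complex.exp_sum]
  simp_rw [Complex.exp_add]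

lemma norm_centeredCharFun_sq_le {ν : Measure ℝ} [IsProbabilityMeasure ν] (ha : |aR ν| ≤ 1 / 2)
    {ε : ℝ} (hs : (canonicalMeasure ν).real Set.univ ≤ ε) (t : ℝ) :
    ‖centeredCharFun ν t‖ ^ 2
      ≤ (2 + 5 * |t| + 3 * t ^ 2) ^ 2 * ε * (canonicalMeasure ν).real Set.univ := by
  have h := norm_centeredCharFun_le ν ha t
  have h0 : 0 ≤ (canonicalMeasure ν).real Set.univ := measureReal_nonneg
  calc ‖centeredCharFun ν t‖ ^ 2
      ≤ ((2 + 5 * |t| + 3 * t ^ 2) * (canonicalMeasure ν).real Set.univ) ^ 2 := by gcongr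
    _ = (2 + 5 * |t| + 3 * t ^ 2) ^ 2 * (canonicalMeasure ν).real Set.univ
        * (canonicalMeasure ν).real Set.univ := by ring
    _ ≤ _ := by gcongr

lemma norm_charFun_sub_exp_levyExponent_le (c : ℝ) (ν : ℕ → Measure ℝ)
    [∀ i, IsProbabilityMeasure (ν i)] (m : ℕ) (t : ℝ) {ε : ℝ}
    (hε : (2 + 5 * |t| + 3 * t ^ 2) * ε ≤ 1) (ha : ∀ i < m, |aR (ν i)| ≤ 1 / 2)
    (hs : ∀ i < m, (canonicalMeasure (ν i)).real Set.univ ≤ ε) :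
    ‖charFun (Measure.conv (Measure.dirac c) (convSeq ν m)) t
        - Complex.exp (levyExponent (sumDrift c ν m) (sumMeasure ν m) t)‖
      ≤ (2 + 5 * |t| + 3 * t ^ 2) ^ 2 * ε * (sumMeasure ν m).real Set.univ := by
  rw [charFun_dirac_conv_convSeq, exp_levyExponent_sum, ← mul_sub, norm_mul,
    norm_exp_I_mul_mul_ofReal, one_mul, sumMeasure_real_univ, Finset.mul_sum]
  refine (norm_prod_sub_prod_le (fun i => ?_) (fun i => ?_) m).trans
    (Finset.sum_le_sum fun i hi => ?_)
  · rw [← charFun_eq_exp_mul]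
    exact norm_charFun_le_one t
  · rw [norm_mul, norm_exp_I_mul_mul_ofReal, one_mul, Complex.norm_exp]
    exact Real.exp_le_one_iff.2 (re_centeredCharFun_nonpos _ _)
  · have him := Finset.mem_range.1 hi
    rw [← mul_sub, norm_mul, norm_exp_I_mul_mul_ofReal, one_mul, norm_sub_rev, ← sub_sub]
    refine (Complex.norm_exp_sub_one_sub_id_le ?_).trans
      (norm_centeredCharFun_sq_le (ha i him) (hs i him) t)
    refine (norm_centeredCharFun_le _ (ha i him) t).trans (le_trans ?_ hε)
    have := hs i him
    gcongr

lemma norm_one_add_sq_le (w : ℂ) : ‖1 + w‖ ^ 2 ≤ Real.exp (2 * w.re + ‖w‖ ^ 2) := by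
  have h : ‖1 + w‖ ^ 2 = 2 * w.re + ‖w‖ ^ 2 + 1 := by
    rw [Complex.sq_norm, Complex.sq_norm, Complex.normSq_apply, Complex.normSq_apply]
    simp
    ring
  rw [h]
  exact Real.add_one_le_exp _

lemma norm_charFun_sq_le (c : ℝ) (ν : ℕ → Measure ℝ)
    [∀ i, IsProbabilityMeasure (ν i)] (m : ℕ) (t : ℝ) {ε : ℝ}
    (ha : ∀ i < m, |aR (ν i)| ≤ 1 / 2)
    (hs : ∀ i < m, (canonicalMeasure (ν i)).real Set.univ ≤ ε) :
    ‖charFun (Measure.conv (Measure.dirac c) (convSeq ν m)) t‖ ^ 2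
      ≤ Real.exp (2 * (levyExponent (sumDrift c ν m) (sumMeasure ν m) t).re
        + (2 + 5 * |t| + 3 * t ^ 2) ^ 2 * ε * (sumMeasure ν m).real Set.univ) := by
  have h1 : (levyExponent (sumDrift c ν m) (sumMeasure ν m) t).re
      = ∑ i ∈ Finset.range m, (centeredCharFun (ν i) t).re := by
    rw [levyExponent_sum, Complex.add_re, Complex.re_sum]
    simp
  rw [h1, sumMeasure_real_univ, Finset.mul_sum, Finset.mul_sum, ← Finset.sum_add_distrib,
    Real.exp_sum, charFun_dirac_conv_convSeq, norm_mul, norm_exp_I_mul_mul_ofReal, one_mul,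
    norm_prod, ← Finset.prod_pow]
  refine Finset.prod_le_prod (fun i _ => by positivity) fun i hi => ?_
  have him := Finset.mem_range.1 hi
  rw [norm_mul, norm_exp_I_mul_mul_ofReal, one_mul]
  refine (norm_one_add_sq_le _).trans (Real.exp_le_exp.2 ?_)
  have := norm_centeredCharFun_sq_le (ha i him) (hs i him) t
  linarith

lemma exists_norm_ET_sub_le {z : ℂ} (hz : 0 < z.im) : ∃ C : ℝ, 2 ≤ C ∧
    ∀ (ν : Measure ℝ) [IsProbabilityMeasure ν] (ε : ℝ), C * ε ≤ 1 → |aR ν| ≤ ε →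
      (canonicalMeasure ν).real Set.univ ≤ ε →
      ‖ET ν z - (aR ν + fR ν z)‖ ≤ C * ε * (canonicalMeasure ν).real Set.univ := by
  set M : ℝ := 5 + (1 + (‖z‖ + 1) ^ 2) / z.im + (‖z‖ + 1) with hM
  set B : ℝ := 1 + (1 + (‖z‖ + 1)) / z.im with hB
  have hM0 : 0 ≤ M := by positivity
  have hB0 : 0 ≤ B := by positivity
  refine ⟨2 / z.im * M ^ 2 + B * B + 2 * M / z.im + 2, ?_, ?_⟩
  · have h1 : 0 ≤ 2 / z.im * M ^ 2 := by positivity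
    have h2 : 0 ≤ 2 * M / z.im := by positivity
    nlinarith
  intro ν _ ε hCε ha hs
  have hε : 0 ≤ ε := (abs_nonneg _).trans ha
  have h1 : 0 ≤ 2 / z.im * M ^ 2 * ε := by positivity
  have h2 : 0 ≤ 2 * M / z.im * ε := by positivity
  have h3 : 0 ≤ B * B * ε := by positivity
  have hε2 : ε ≤ 1 / 2 := by nlinarith
  have hMε : M * ε ≤ z.im / 2 := by
    have : 2 * M / z.im * ε ≤ 1 := by nlinarith
    rw [div_mul_eq_mul_div, div_le_iff₀ hz] at this
    linarith
  have hs0 : 0 ≤ (canonicalMeasure ν).real Set.univ := measureReal_nonneg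
  have ha2 : |aR ν| ≤ 1 / 2 := ha.trans hε2
  have hwim : (z - aR ν : ℂ).im = z.im := by simp
  have hwz : 0 < (z - aR ν : ℂ).im := by rw [hwim]; exact hz
  have hwn : ‖(z - aR ν : ℂ)‖ ≤ ‖z‖ + 1 := by
    refine (norm_sub_le _ _).trans ?_
    rw [Complex.norm_real, Real.norm_eq_abs]
    linarith
  have hf : ‖fR ν (z - aR ν)‖ ≤ M * (canonicalMeasure ν).real Set.univ := by
    refine (norm_fR_le hwz ν ha2).trans ?_
    rw [hwim, hM]
    gcongr
  have hf2 : ‖fR ν (z - aR ν)‖ ≤ z.im / 2 := hf.trans (le_trans (by gcongr) hMε)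
  have e1 := norm_ET_sub_le hz ν hf2
  have e2 : ‖fR ν (z - aR ν) - fR ν z‖ ≤ ε * (B * B) * (canonicalMeasure ν).real Set.univ := by
    refine (norm_fR_sub_fR_le hz hwz ν).trans ?_
    rw [hwim, sub_sub_cancel, Complex.norm_real, Real.norm_eq_abs, hB]
    have : ‖z‖ ≤ ‖z‖ + 1 := by linarith
    gcongr
  have e3 : 2 / z.im * ‖fR ν (z - aR ν)‖ ^ 2
      ≤ 2 / z.im * M ^ 2 * ε * (canonicalMeasure ν).real Set.univ := by
    calc 2 / z.im * ‖fR ν (z - aR ν)‖ ^ 2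
        ≤ 2 / z.im * (M * (canonicalMeasure ν).real Set.univ) ^ 2 := by gcongr
      _ = 2 / z.im * M ^ 2 * (canonicalMeasure ν).real Set.univ
          * (canonicalMeasure ν).real Set.univ := by ring
      _ ≤ _ := by gcongr
  have e4 : ‖ET ν z - (aR ν + fR ν z)‖ ≤ ‖ET ν z - (aR ν + fR ν (z - aR ν))‖
      + ‖fR ν (z - aR ν) - fR ν z‖ := by
    refine le_trans (le_of_eq ?_) (norm_add_le _ _)
    congr 1
    ring
  have h4 : 0 ≤ (2 * M / z.im + 2) * ε * (canonicalMeasure ν).real Set.univ := by positivity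
  nlinarith

/-- The boolean convolution of a row is approximated by the Nevanlinna function of the row. -/
lemma exists_norm_sum_ET_sub_nevanlinna_le {z : ℂ} (hz : 0 < z.im) : ∃ C : ℝ, 2 ≤ C ∧
    ∀ (c : ℝ) (ν : ℕ → Measure ℝ) [∀ i, IsProbabilityMeasure (ν i)] (m : ℕ) (ε : ℝ),
      C * ε ≤ 1 →
      (∀ i < m, |aR (ν i)| ≤ ε ∧ (canonicalMeasure (ν i)).real Set.univ ≤ ε) →
      ‖(c + ∑ i ∈ Finset.range m, ET (ν i) z)
          - nevanlinna (sumDrift c ν m) (sumMeasure ν m) z‖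
        ≤ C * ε * (sumMeasure ν m).real Set.univ := by
  obtain ⟨C, hC, h⟩ := exists_norm_ET_sub_le hz
  refine ⟨C, hC, fun c ν _ m ε hε hi => ?_⟩
  rw [nevanlinna_sum hz, add_sub_add_left_eq_sub, ← Finset.sum_sub_distrib, sumMeasure_real_univ,
    Finset.mul_sum]
  refine norm_sum_le_of_le _ fun i him => ?_
  have him' := Finset.mem_range.1 him
  exact h (ν i) ε hε (hi i him').1 (hi i him').2

/-- The total mass of the Lévy measure in terms of the real part of the Lévy exponent. -/
lemma real_univ_eq_integral_re_levyExponent (γ : ℝ) (σ : Measure ℝ) [IsFiniteMeasure σ] :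
    σ.real Set.univ
      = ∫ t in Set.Ioi (0 : ℝ), -(Real.exp (-t) * (levyExponent γ σ (-t)).re) := by
  have hI : 0 < (I : ℂ).im := by simp
  have h1 := nevanlinna_eq_integral hI γ σ
  rw [nevanlinna_I, I_sq] at h1
  have hInt : IntegrableOn (fun t : ℝ => Complex.exp (I * I * t) * levyExponent γ σ (-t))
      (Set.Ioi 0) := by
    refine Integrable.mono' (integrableOn_exp_mul_add_sq hI |γ| (2 * σ.real Set.univ)
      (3 * σ.real Set.univ)) (Continuous.aestronglyMeasurable ?_)
      (ae_of_all _ (norm_cexp_mul_levyExponent_le I γ σ le_rfl le_rfl))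
    have := continuous_levyExponent γ σ
    fun_prop
  have h2 := integral_re hInt
  simp only [RCLike.re_eq_complex_re] at h2
  have h3 : -σ.real Set.univ
      = (∫ t in Set.Ioi (0 : ℝ), Complex.exp (I * I * t) * levyExponent γ σ (-t)).re := by
    simpa using congrArg Complex.im h1
  rw [integral_neg, ← neg_eq_iff_eq_neg, h3, ← h2]
  refine integral_congr_ae (ae_of_all _ fun t => ?_)
  have : Complex.exp (I * I * t) = ((Real.exp (-t) : ℝ) : ℂ) := by
    rw [I_mul_I]
    push_cast
    ring_nf
  simp only [this, Complex.re_ofReal_mul]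

lemma im_inv_sub_ofReal_neg {z : ℂ} (hz : 0 < z.im) (t : ℝ) : ((z - (t : ℂ))⁻¹).im < 0 := by
  rw [Complex.inv_im]
  have h : 0 < normSq (z - (t : ℂ)) := normSq_pos.2 (sub_ofReal_ne_zero hz.ne' t)
  have him : (z - (t : ℂ)).im = z.im := by simp
  rw [him, neg_div]
  exact neg_neg_of_pos (div_pos hz h)

lemma cauchyT_ne_zero (μ : Measure ℝ) [IsProbabilityMeasure μ] {z : ℂ} (hz : 0 < z.im) :
    cauchyT μ z ≠ 0 := by
  intro h
  have hInt := integrable_resolvent μ hz.ne'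
  have him : ∫ t : ℝ, -((z - (t : ℂ))⁻¹).im ∂μ = 0 := by
    have h1 : ∫ t : ℝ, ((z - (t : ℂ))⁻¹).im ∂μ = (cauchyT μ z).im := integral_im hInt
    rw [integral_neg, h1, h]
    simp
  have hpos := (integral_pos_iff_support_of_nonneg (μ := μ)
    (fun t => (neg_pos.2 (im_inv_sub_ofReal_neg hz t)).le) hInt.im.neg).2
  have hsupp : Function.support (fun t : ℝ => -((z - (t : ℂ))⁻¹).im) = Set.univ :=
    Set.eq_univ_of_forall fun t => (neg_pos.2 (im_inv_sub_ofReal_neg hz t)).ne'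
  have h2 := hpos (by
    change 0 < μ (Function.support (fun t : ℝ => -((z - (t : ℂ))⁻¹).im))
    rw [hsupp]
    simp)
  exact h2.ne' him

lemma cauchyT_eq_inv_sub_ET (μ : Measure ℝ) (z : ℂ) : cauchyT μ z = (z - ET μ z)⁻¹ := by
  simp [ET]

lemma sub_ET_ne_zero (μ : Measure ℝ) [IsProbabilityMeasure μ] {z : ℂ} (hz : 0 < z.im) :
    z - ET μ z ≠ 0 := by
  simpa [ET] using cauchyT_ne_zero μ hz

lemma tendsto_cauchyT_iff_tendsto_ET {μ : ℕ → Measure ℝ} {μ₀ : Measure ℝ}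
    [IsProbabilityMeasure μ₀] {z : ℂ} (hz : 0 < z.im) :
    Tendsto (fun n => cauchyT (μ n) z) atTop (𝓝 (cauchyT μ₀ z)) ↔
      Tendsto (fun n => ET (μ n) z) atTop (𝓝 (ET μ₀ z)) := by
  refine ⟨fun h => (h.inv₀ (cauchyT_ne_zero μ₀ hz)).const_sub z, fun h => ?_⟩
  simp_rw [cauchyT_eq_inv_sub_ET]
  exact (h.const_sub z).inv₀ (sub_ET_ne_zero μ₀ hz)

lemma tendsto_cauchyT {μ : ℕ → ProbabilityMeasure ℝ} {μ₀ : ProbabilityMeasure ℝ}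
    (h : Tendsto μ atTop (𝓝 μ₀)) {z : ℂ} (hz : 0 < z.im) :
    Tendsto (fun n => cauchyT (μ n) z) atTop (𝓝 (cauchyT μ₀ z)) :=
  (ProbabilityMeasure.tendsto_iff_forall_integral_rclike_tendsto ℂ).1 h
    (BoundedContinuousFunction.ofNormedAddCommGroup (fun t : ℝ => (z - (t : ℂ))⁻¹)
      (continuous_resolvent hz.ne') _ (norm_resolvent_le hz.ne'))

/-- Weak convergence to a probability measure is pointwise convergence of the energy transforms on
the upper half-plane. -/
theorem tendsto_iff_tendsto_ET {μ : ℕ → ProbabilityMeasure ℝ} {μ₀ : ProbabilityMeasure ℝ} :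
    Tendsto μ atTop (𝓝 μ₀) ↔
      ∀ z : ℂ, 0 < z.im → Tendsto (fun n => ET (μ n) z) atTop (𝓝 (ET μ₀ z)) :=
  ⟨fun h _ hz => (tendsto_cauchyT_iff_tendsto_ET hz).1 (tendsto_cauchyT h hz), fun h =>
    tendsto_of_tendsto_cauchyT fun z hz =>
      (tendsto_cauchyT_iff_tendsto_ET (zero_lt_one.trans hz)).2 (h z (zero_lt_one.trans hz))⟩

section Approximation

variable {kn : ℕ → ℕ} {ν : ℕ → ℕ → Measure ℝ} [∀ n i, IsProbabilityMeasure (ν n i)]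

lemma eventually_norm_sum_ET_sub_nevanlinna_le (hinf : IsInfinitesimalArrayR kn ν) (c : ℕ → ℝ)
    {z : ℂ} (hz : 0 < z.im) {η : ℝ} (hη : 0 < η) :
    ∀ᶠ n in atTop, ‖(c n + ∑ i ∈ Finset.range (kn n), ET (ν n i) z)
        - nevanlinna (sumDrift (c n) (ν n) (kn n)) (sumMeasure (ν n) (kn n)) z‖
      ≤ η * (sumMeasure (ν n) (kn n)).real Set.univ := by
  obtain ⟨C, hC, h⟩ := exists_norm_sum_ET_sub_nevanlinna_le hz
  have hC0 : 0 < C := by linarith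
  have hmin : 0 < min η 1 := lt_min hη one_pos
  have heq : C * (min η 1 / C) = min η 1 := by field_simp
  filter_upwards [hinf.eventually_le inferInstance (div_pos hmin hC0)] with n hn
  refine (h (c n) (ν n) (kn n) _ ?_ hn).trans ?_
  · rw [heq]
    exact min_le_right _ _
  · rw [heq]
    gcongr
    exact min_le_left _ _

lemma exists_pos_forall_mul_le {η : ℝ} (hη : 0 < η) (t : ℝ) : ∃ ε : ℝ, 0 < ε ∧ ε ≤ 1 / 2 ∧
    (2 + 5 * |t| + 3 * t ^ 2) * ε ≤ 1 ∧ (2 + 5 * |t| + 3 * t ^ 2) ^ 2 * ε ≤ η := by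
  set K : ℝ := 2 + 5 * |t| + 3 * t ^ 2 with hK
  have hK2 : 2 ≤ K := by
    have := abs_nonneg t
    have := sq_nonneg t
    linarith
  have hK0 : 0 < K := by linarith
  have hmin : 0 < min η 1 := lt_min hη one_pos
  have h1 := min_le_left η 1
  have h2 := min_le_right η 1
  refine ⟨min η 1 / K ^ 2, by positivity, ?_, ?_, ?_⟩
  · rw [div_le_iff₀ (by positivity)]
    nlinarith
  · rw [mul_div_assoc', div_le_one (by positivity)]
    nlinarith
  · rw [mul_div_cancel₀ _ (by positivity)]
    exact h1

lemma eventually_norm_charFun_sub_exp_levyExponent_le (hinf : IsInfinitesimalArrayR kn ν)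
    (c : ℕ → ℝ) (T : ℝ) {η : ℝ} (hη : 0 < η) :
    ∀ᶠ n in atTop, ∀ t : ℝ, |t| ≤ T → ‖charFun (rhoN c kn ν n) t
        - Complex.exp (levyExponent (sumDrift (c n) (ν n) (kn n)) (sumMeasure (ν n) (kn n)) t)‖
      ≤ η * (sumMeasure (ν n) (kn n)).real Set.univ := by
  obtain ⟨ε, hε0, hε1, hε2, hε3⟩ := exists_pos_forall_mul_le hη |T|
  filter_upwards [hinf.eventually_le inferInstance hε0] with n hn t ht
  have htT : |t| ≤ |T| := ht.trans (le_abs_self T)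
  have hle : 2 + 5 * |t| + 3 * t ^ 2 ≤ 2 + 5 * |(|T|)| + 3 * |T| ^ 2 := by
    rw [abs_abs, ← sq_abs t]
    gcongr
  have h0 : 0 ≤ 2 + 5 * |t| + 3 * t ^ 2 := by positivity
  refine (norm_charFun_sub_exp_levyExponent_le (c n) (ν n) (kn n) t
    ((mul_le_mul_of_nonneg_right hle hε0.le).trans hε2)
    (fun i hi => (hn i hi).1.trans hε1) (fun i hi => (hn i hi).2)).trans ?_
  refine mul_le_mul_of_nonneg_right (le_trans ?_ hε3) measureReal_nonneg
  gcongr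

lemma eventually_norm_charFun_sq_le (hinf : IsInfinitesimalArrayR kn ν) (c : ℕ → ℝ) (t : ℝ)
    {η : ℝ} (hη : 0 < η) :
    ∀ᶠ n in atTop, ‖charFun (rhoN c kn ν n) t‖ ^ 2 ≤ Real.exp
      (2 * (levyExponent (sumDrift (c n) (ν n) (kn n)) (sumMeasure (ν n) (kn n)) t).re
        + η * (sumMeasure (ν n) (kn n)).real Set.univ) := by
  obtain ⟨ε, hε0, hε1, -, hε3⟩ := exists_pos_forall_mul_le hη t
  filter_upwards [hinf.eventually_le inferInstance hε0] with n hn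
  refine (norm_charFun_sq_le (c n) (ν n) (kn n) t (fun i hi => (hn i hi).1.trans hε1)
    (fun i hi => (hn i hi).2)).trans ?_
  gcongr

end Approximation

/-- A family that is eventually `η * S n`-small for every `η > 0` tends to zero when `S` is
eventually bounded. -/
lemma tendsto_zero_of_eventually_norm_le_mul {E : Type*} [SeminormedAddCommGroup E] {f : ℕ → E}
    {S : ℕ → ℝ} {B : ℝ} (hB : ∀ᶠ n in atTop, S n ≤ B)
    (h : ∀ η : ℝ, 0 < η → ∀ᶠ n in atTop, ‖f n‖ ≤ η * S n) : Tendsto f atTop (𝓝 0) := by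
  rw [NormedAddGroup.tendsto_nhds_zero]
  intro ε hε
  have hB0 : 0 < |B| + 1 := by positivity
  filter_upwards [hB, h (ε / (|B| + 1)) (by positivity)] with n h1 h2
  refine h2.trans_lt ?_
  rw [div_mul_eq_mul_div, div_lt_iff₀ hB0]
  have := le_abs_self B
  exact mul_lt_mul_of_pos_left (by linarith) hε

lemma norm_charFun_sub_charFun_le (μ : Measure ℝ) [IsProbabilityMeasure μ] {x y h : ℝ}
    (hxy : |y - x| ≤ h) : ‖charFun μ y - charFun μ x‖ ≤ ∫ u, min 2 (h * |u|) ∂μ := by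
  have hInt : ∀ s : ℝ, Integrable (fun u : ℝ => Complex.exp (s * u * I)) μ := fun s => by
    refine Integrable.of_bound (by fun_prop) 1 (ae_of_all _ fun u => ?_)
    rw [← ofReal_mul, Complex.norm_exp_ofReal_mul_I]
  have h0 : 0 ≤ h := (abs_nonneg _).trans hxy
  rw [charFun_apply_real, charFun_apply_real, ← integral_sub (hInt y) (hInt x)]
  refine norm_integral_le_of_norm_le ?_ (ae_of_all _ fun u => ?_)
  · refine Integrable.of_bound (by fun_prop) 2 (ae_of_all _ fun u => ?_)
    rw [Real.norm_of_nonneg (by positivity)]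
    exact min_le_left _ _
  · refine le_min ?_ ?_
    · refine (norm_sub_le _ _).trans ?_
      rw [← ofReal_mul, Complex.norm_exp_ofReal_mul_I, ← ofReal_mul,
        Complex.norm_exp_ofReal_mul_I]
      norm_num
    · have heq : Complex.exp (y * u * I) - Complex.exp (x * u * I)
          = Complex.exp ((x * u : ℝ) * I) * (Complex.exp (I * ((y - x) * u : ℝ)) - 1) := by
        rw [mul_sub, ← Complex.exp_add]
        push_cast
        ring_nf
      rw [heq, norm_mul, Complex.norm_exp_ofReal_mul_I, one_mul]
      refine Real.norm_exp_I_mul_ofReal_sub_one_le.trans ?_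
      rw [norm_mul, Real.norm_eq_abs, Real.norm_eq_abs]
      gcongr

lemma tendsto_integral_min_mul_abs (μ : Measure ℝ) [IsProbabilityMeasure μ] :
    Tendsto (fun h : ℝ => ∫ u, min 2 (h * |u|) ∂μ) (𝓝[>] 0) (𝓝 0) := by
  suffices h : Tendsto (fun h : ℝ => ∫ u, min 2 (h * |u|) ∂μ) (𝓝[>] 0) (𝓝 (∫ _, (0 : ℝ) ∂μ)) by
    rwa [integral_zero] at h
  refine tendsto_integral_filter_of_dominated_convergence (fun _ => 2)
    (Eventually.of_forall fun h => by fun_prop) ?_ (integrable_const _)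
    (ae_of_all _ fun u => ?_)
  · filter_upwards [self_mem_nhdsWithin] with h hh
    refine ae_of_all _ fun u => ?_
    have : 0 < h := hh
    rw [Real.norm_of_nonneg (by positivity)]
    exact min_le_left _ _
  · have hc : Continuous fun h : ℝ => min 2 (h * |u|) := by fun_prop
    have := hc.tendsto 0
    simp only [zero_mul, min_eq_right (zero_le_two : (0 : ℝ) ≤ 2)] at this
    exact this.mono_left nhdsWithin_le_nhds

/-- Under weak convergence the characteristic functions converge locally uniformly. -/
theorem tendstoLocallyUniformly_charFun {μ : ℕ → ProbabilityMeasure ℝ} {μ₀ : ProbabilityMeasure ℝ}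
    (h : Tendsto μ atTop (𝓝 μ₀)) :
    TendstoLocallyUniformly (fun n => charFun (μ n : Measure ℝ)) (charFun (μ₀ : Measure ℝ))
      atTop := by
  rw [Metric.tendstoLocallyUniformly_iff]
  intro ε hε x
  have hev := (tendsto_integral_min_mul_abs (μ₀ : Measure ℝ)).eventually
    (gt_mem_nhds (show (0 : ℝ) < ε / 3 by positivity))
  obtain ⟨δ, hδ, hδ0⟩ := (hev.and self_mem_nhdsWithin).exists
  replace hδ0 : 0 < δ := hδ0
  have hconv := (ProbabilityMeasure.tendsto_iff_forall_integral_tendsto.1 h)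
    (BoundedContinuousFunction.ofNormedAddCommGroup (fun u : ℝ => min 2 (δ * |u|))
      (by fun_prop) 2 (fun u => by
        rw [Real.norm_of_nonneg (by positivity)]
        exact min_le_left _ _))
  have hx := (ProbabilityMeasure.tendsto_iff_tendsto_charFun.1 h) x
  refine ⟨Metric.ball x δ, Metric.ball_mem_nhds x hδ0, ?_⟩
  filter_upwards [hconv.eventually (gt_mem_nhds hδ),
    (Metric.tendsto_nhds.1 hx) (ε / 3) (by positivity)] with n h1 h2 y hy
  replace h1 : ∫ u, min 2 (δ * |u|) ∂(μ n : Measure ℝ) < ε / 3 := h1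
  have hy' : |y - x| ≤ δ := by
    rw [Metric.mem_ball, Real.dist_eq] at hy
    exact hy.le
  have h3 := norm_charFun_sub_charFun_le (μ n : Measure ℝ) hy'
  have h4 := norm_charFun_sub_charFun_le (μ₀ : Measure ℝ) hy'
  rw [← dist_eq_norm] at h3 h4
  have h5 := dist_triangle4 (charFun (μ₀ : Measure ℝ) y) (charFun (μ₀ : Measure ℝ) x)
    (charFun (μ n : Measure ℝ) x) (charFun (μ n : Measure ℝ) y)
  rw [dist_comm (charFun (μ₀ : Measure ℝ) x) (charFun (μ n : Measure ℝ) x),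
    dist_comm (charFun (μ n : Measure ℝ) x) (charFun (μ n : Measure ℝ) y)] at h5
  linarith

lemma abs_im_lt_pi_div_two_of_re_exp_pos {D : ℝ → ℂ} (hD : Continuous D) (h0 : D 0 = 0) {t : ℝ}
    (h : ∀ s ∈ Set.uIcc 0 t, 0 < (Complex.exp (D s)).re) : |(D t).im| < Real.pi / 2 := by
  by_contra! hcon
  have hcont : ContinuousOn (fun s => |(D s).im|) (Set.uIcc 0 t) := by fun_prop
  have hmem : Real.pi / 2 ∈ Set.uIcc |(D 0).im| |(D t).im| := by
    rw [h0]
    simp only [zero_im, abs_zero]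
    rw [Set.uIcc_of_le (abs_nonneg _)]
    exact ⟨by positivity, hcon⟩
  obtain ⟨s, hs, hs'⟩ := intermediate_value_uIcc hcont hmem
  have h1 := h s hs
  rw [Complex.exp_re, ← Real.cos_abs (D s).im] at h1
  simp only at hs'
  rw [hs', Real.cos_pi_div_two, mul_zero] at h1
  exact h1.false

/-- Continuous logarithms normalised at `0` converge when their exponentials converge locally
uniformly. -/
theorem tendsto_of_tendstoLocallyUniformly_exp {L : ℕ → ℝ → ℂ} {L₀ : ℝ → ℂ}
    (hL : ∀ n, Continuous (L n)) (hL₀ : Continuous L₀) (h0 : ∀ n, L n 0 = 0) (h00 : L₀ 0 = 0)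
    (h : TendstoLocallyUniformly (fun n s => Complex.exp (L n s)) (fun s => Complex.exp (L₀ s))
      atTop) (t : ℝ) : Tendsto (fun n => L n t) atTop (𝓝 (L₀ t)) := by
  have hK : IsCompact (Set.uIcc 0 t) := isCompact_uIcc
  have hunif := Metric.tendstoUniformlyOn_iff.1
    (tendstoLocallyUniformly_iff_forall_isCompact.1 h _ hK)
  obtain ⟨s₀, -, hs₀⟩ := hK.exists_isMinOn ⟨0, Set.left_mem_uIcc⟩
    (f := fun s => ‖Complex.exp (L₀ s)‖) (by fun_prop)
  have hratio : ∀ n s, Complex.exp (L n s - L₀ s)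
      = 1 + (Complex.exp (L n s) - Complex.exp (L₀ s)) / Complex.exp (L₀ s) := fun n s => by
    rw [Complex.exp_sub]
    field_simp [Complex.exp_ne_zero]
    ring
  have hlog : ∀ᶠ n in atTop,
      Complex.log (Complex.exp (L n t - L₀ t)) = L n t - L₀ t := by
    filter_upwards [hunif ‖Complex.exp (L₀ s₀)‖ (norm_pos_iff.2 (Complex.exp_ne_zero _))]
      with n hn
    have him := abs_im_lt_pi_div_two_of_re_exp_pos (D := fun s => L n s - L₀ s)
      ((hL n).sub hL₀) (by simp [h0, h00]) (t := t) (fun s hs => by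
        rw [hratio, Complex.add_re, one_re]
        have h1 := (hn s hs).trans_le (hs₀ hs)
        rw [dist_comm, dist_eq_norm] at h1
        have h2 : ‖(Complex.exp (L n s) - Complex.exp (L₀ s)) / Complex.exp (L₀ s)‖ < 1 := by
          rw [norm_div, div_lt_one (norm_pos_iff.2 (Complex.exp_ne_zero _))]
          exact h1
        have h3 := (abs_lt.1 ((Complex.abs_re_le_norm _).trans_lt h2)).1
        linarith)
    have hpi := Real.pi_pos
    rw [abs_lt] at him
    exact Complex.log_exp (by linarith [him.1]) (by linarith [him.2])
  have hexp : Tendsto (fun n => Complex.exp (L n t - L₀ t)) atTop (𝓝 1) := by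
    have h1 : Tendsto (fun n => Complex.exp (L n t)) atTop (𝓝 (Complex.exp (L₀ t))) :=
      Metric.tendsto_nhds.2 fun ε hε => (hunif ε hε).mono fun n hn => by
        rw [dist_comm]
        exact hn t Set.right_mem_uIcc
    simp_rw [Complex.exp_sub]
    simpa [div_self (Complex.exp_ne_zero _)] using h1.div_const (Complex.exp (L₀ t))
  have h2 := (hexp.clog (by simp)).congr' hlog
  rw [Complex.log_one] at h2
  simpa using h2.add_const (L₀ t)

lemma abs_re_levyExponent_le (γ : ℝ) (σ : Measure ℝ) [IsFiniteMeasure σ] (t : ℝ) :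
    |(levyExponent γ σ t).re| ≤ (2 + 3 * t ^ 2) * σ.real Set.univ := by
  rw [re_levyExponent]
  exact (Complex.abs_re_le_norm _).trans (norm_integral_levyKernel_le σ t)

/-- If `|φ n t| ^ 2` stays away from zero and is controlled by Lévy exponents, then the Lévy
measures have bounded mass. -/
theorem exists_eventually_real_univ_le {γ : ℕ → ℝ} {σ : ℕ → Measure ℝ}
    [∀ n, IsFiniteMeasure (σ n)] {q : ℕ → ℝ → ℝ}
    (hq : ∀ t, ∃ r : ℝ, 0 < r ∧ ∀ᶠ n in atTop, r ≤ q n t)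
    (h : ∀ t η : ℝ, 0 < η → ∀ᶠ n in atTop,
      q n t ≤ Real.exp (2 * (levyExponent (γ n) (σ n) t).re + η * (σ n).real Set.univ)) :
    ∃ B : ℝ, ∀ᶠ n in atTop, (σ n).real Set.univ ≤ B := by
  by_contra! hcon
  have hfreq : ∀ k : ℕ, ∃ᶠ n in atTop, (k : ℝ) + 1 < (σ n).real Set.univ := fun k => by
    simpa [not_eventually] using hcon (k + 1)
  obtain ⟨φ, hφ, hφS⟩ := extraction_forall_of_frequently hfreq
  have hS0 : ∀ k, 0 < (σ (φ k)).real Set.univ := fun k => by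
    have := hφS k
    have : (0 : ℝ) ≤ k := by positivity
    linarith
  have hStop : Tendsto (fun k => (σ (φ k)).real Set.univ) atTop atTop :=
    tendsto_atTop_mono (fun k => (by linarith [hφS k] : (k : ℝ) ≤ _))
      tendsto_natCast_atTop_atTop
  have hlim : ∀ t, Tendsto (fun k => (levyExponent (γ (φ k)) (σ (φ k)) t).re
      / (σ (φ k)).real Set.univ) atTop (𝓝 0) := fun t => by
    obtain ⟨r, hr, hrq⟩ := hq t
    rw [Metric.tendsto_nhds]
    intro ε hε
    filter_upwards [hφ.tendsto_atTop.eventually hrq, hφ.tendsto_atTop.eventually (h t ε hε),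
      hStop.eventually_gt_atTop (-Real.log r / ε)] with k h1 h2 h3
    have h4 := (Real.log_le_iff_le_exp hr).2 (h1.trans h2)
    have h5 := re_levyExponent_nonpos (γ (φ k)) (σ (φ k)) t
    rw [div_lt_iff₀ hε] at h3
    rw [Real.dist_0_eq_abs, abs_div, abs_of_pos (hS0 k), abs_of_nonpos h5,
      div_lt_iff₀ (hS0 k)]
    linarith
  have hInt : Tendsto (fun k => ∫ t in Set.Ioi (0 : ℝ), -(Real.exp (-t)
      * ((levyExponent (γ (φ k)) (σ (φ k)) (-t)).re / (σ (φ k)).real Set.univ))) atTop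
      (𝓝 (∫ t in Set.Ioi (0 : ℝ), -(Real.exp (-t) * 0))) := by
    refine tendsto_integral_filter_of_dominated_convergence
      (fun t => Real.exp (-1 * t) * (0 * |t| + (2 + 3 * t ^ 2)))
      (Eventually.of_forall fun k => ?_) (Eventually.of_forall fun k => ae_of_all _ fun t => ?_)
      (integrableOn_exp_mul_add_sq one_pos 0 2 3)
      (ae_of_all _ fun t => ((hlim (-t)).const_mul _).neg)
    · have hc := continuous_levyExponent (γ (φ k)) (σ (φ k))
      have : Continuous fun t : ℝ => -(Real.exp (-t)
          * ((levyExponent (γ (φ k)) (σ (φ k)) (-t)).re / (σ (φ k)).real Set.univ)) :=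
        (Continuous.mul (by fun_prop)
          ((Complex.continuous_re.comp (hc.comp continuous_neg)).div_const _)).neg
      exact this.aestronglyMeasurable
    · rw [norm_neg, norm_mul, Real.norm_of_nonneg (Real.exp_pos _).le, Real.norm_eq_abs,
        abs_div, abs_of_pos (hS0 k), neg_one_mul, zero_mul, zero_add]
      gcongr
      rw [div_le_iff₀ (hS0 k)]
      simpa using abs_re_levyExponent_le (γ (φ k)) (σ (φ k)) (-t)
  have hone : ∀ k, ∫ t in Set.Ioi (0 : ℝ), -(Real.exp (-t)
      * ((levyExponent (γ (φ k)) (σ (φ k)) (-t)).re / (σ (φ k)).real Set.univ)) = 1 := fun k => by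
    simp_rw [mul_div_assoc', ← neg_div]
    rw [integral_div, ← real_univ_eq_integral_re_levyExponent, div_self (hS0 k).ne']
  simp_rw [hone] at hInt
  simp only [mul_zero, neg_zero, integral_zero] at hInt
  exact one_ne_zero (tendsto_nhds_unique tendsto_const_nhds hInt)

instance isProbabilityMeasure_rhoN (c : ℕ → ℝ) (kn : ℕ → ℕ) (ν : ℕ → ℕ → Measure ℝ)
    [∀ n i, IsProbabilityMeasure (ν n i)] (n : ℕ) : IsProbabilityMeasure (rhoN c kn ν n) := by
  unfold rhoN
  infer_instance

section LimitTheorem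

variable {kn : ℕ → ℕ} {ν : ℕ → ℕ → Measure ℝ} [∀ n i, IsProbabilityMeasure (ν n i)]

/-- Classical limit theorem for infinitesimal arrays with bounded total mass, in terms of Lévy
exponents. -/
lemma tendsto_charFun_sub_exp_levyExponent (hinf : IsInfinitesimalArrayR kn ν) (c : ℕ → ℝ)
    {B : ℝ} (hB : ∀ᶠ n in atTop, (sumMeasure (ν n) (kn n)).real Set.univ ≤ B) (t : ℝ) :
    Tendsto (fun n => charFun (rhoN c kn ν n) t
      - Complex.exp (levyExponent (sumDrift (c n) (ν n) (kn n)) (sumMeasure (ν n) (kn n)) t))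
      atTop (𝓝 0) :=
  tendsto_zero_of_eventually_norm_le_mul hB fun _ hη =>
    (eventually_norm_charFun_sub_exp_levyExponent_le hinf c |t| hη).mono fun _ h => h t le_rfl

lemma tendsto_sum_ET_sub_nevanlinna (hinf : IsInfinitesimalArrayR kn ν) (c : ℕ → ℝ)
    {B : ℝ} (hB : ∀ᶠ n in atTop, (sumMeasure (ν n) (kn n)).real Set.univ ≤ B)
    {z : ℂ} (hz : 0 < z.im) :
    Tendsto (fun n => (c n + ∑ i ∈ Finset.range (kn n), ET (ν n i) z)
      - nevanlinna (sumDrift (c n) (ν n) (kn n)) (sumMeasure (ν n) (kn n)) z) atTop (𝓝 0) :=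
  tendsto_zero_of_eventually_norm_le_mul hB fun _ hη =>
    eventually_norm_sum_ET_sub_nevanlinna_le hinf c hz hη

lemma real_univ_le_norm_nevanlinna_I (γ : ℝ) (σ : Measure ℝ) :
    σ.real Set.univ ≤ ‖nevanlinna γ σ I‖ := by
  refine le_trans ?_ (Complex.abs_im_le_norm _)
  rw [nevanlinna_I]
  simp [abs_of_nonneg]

lemma exists_eventually_real_univ_le_of_tendsto_sum_ET (hinf : IsInfinitesimalArrayR kn ν)
    (c : ℕ → ℝ) {w : ℂ}
    (h : Tendsto (fun n => c n + ∑ i ∈ Finset.range (kn n), ET (ν n i) I) atTop (𝓝 w)) :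
    ∃ B : ℝ, ∀ᶠ n in atTop, (sumMeasure (ν n) (kn n)).real Set.univ ≤ B := by
  refine ⟨2 * (‖w‖ + 1), ?_⟩
  filter_upwards [eventually_norm_sum_ET_sub_nevanlinna_le hinf c (z := I) (by simp)
    (η := 1 / 2) (by norm_num), h.norm.eventually (ge_mem_nhds (lt_add_one ‖w‖))] with n h1 h2
  have h3 := real_univ_le_norm_nevanlinna_I (sumDrift (c n) (ν n) (kn n))
    (sumMeasure (ν n) (kn n))
  have h4 := norm_le_norm_add_norm_sub'
    (nevanlinna (sumDrift (c n) (ν n) (kn n)) (sumMeasure (ν n) (kn n)) I)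
    (c n + ∑ i ∈ Finset.range (kn n), ET (ν n i) I)
  rw [norm_sub_rev] at h4
  linarith

/-- Boolean convergence forces classical convergence of characteristic functions. -/
theorem tendsto_charFun_of_tendsto_sum_ET (hinf : IsInfinitesimalArrayR kn ν) (c : ℕ → ℝ)
    {γ : ℝ} {σ : Measure ℝ} [IsFiniteMeasure σ]
    (h : ∀ z : ℂ, 0 < z.im → Tendsto (fun n => c n + ∑ i ∈ Finset.range (kn n), ET (ν n i) z)
      atTop (𝓝 (nevanlinna γ σ z))) (t : ℝ) :
    Tendsto (fun n => charFun (rhoN c kn ν n) t) atTop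
      (𝓝 (Complex.exp (levyExponent γ σ t))) := by
  obtain ⟨B, hB⟩ := exists_eventually_real_univ_le_of_tendsto_sum_ET hinf c (h I (by simp))
  have hL := tendsto_levyExponent_of_tendsto_nevanlinna (fun z hz => by
    simpa using (h z hz).sub (tendsto_sum_ET_sub_nevanlinna hinf c hB hz)) t
  simpa using (tendsto_charFun_sub_exp_levyExponent hinf c hB t).add hL.cexp

lemma abs_drift_le (γ : ℝ) (σ : Measure ℝ) [IsFiniteMeasure σ] :
    |γ| ≤ ‖levyExponent γ σ 1‖ + 5 * σ.real Set.univ := by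
  have h1 := norm_integral_levyKernel_le σ 1
  have h2 : (γ : ℂ) = -I * (levyExponent γ σ 1 - ∫ x, levyKernel 1 x ∂σ) := by
    rw [levyExponent, add_sub_cancel_right]
    push_cast
    linear_combination (γ : ℂ) * I_sq
  rw [← Real.norm_eq_abs, ← Complex.norm_real, h2, norm_mul, norm_neg, norm_I, one_mul]
  refine (norm_sub_le _ _).trans ?_
  linarith

/-- Classical convergence forces boolean convergence of energy transforms. -/
theorem tendsto_sum_ET_of_tendstoLocallyUniformly_charFun (hinf : IsInfinitesimalArrayR kn ν)
    (c : ℕ → ℝ) {γ : ℝ} {σ : Measure ℝ} [IsFiniteMeasure σ]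
    (h : TendstoLocallyUniformly (fun n => charFun (rhoN c kn ν n))
      (fun t => Complex.exp (levyExponent γ σ t)) atTop) {z : ℂ} (hz : 0 < z.im) :
    Tendsto (fun n => c n + ∑ i ∈ Finset.range (kn n), ET (ν n i) z) atTop
      (𝓝 (nevanlinna γ σ z)) := by
  obtain ⟨B, hB⟩ := exists_eventually_real_univ_le
    (γ := fun n => sumDrift (c n) (ν n) (kn n)) (σ := fun n => sumMeasure (ν n) (kn n))
    (q := fun n t => ‖charFun (rhoN c kn ν n) t‖ ^ 2) (fun t => by
      have hpos : 0 < ‖Complex.exp (levyExponent γ σ t)‖ ^ 2 :=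
        pow_pos (norm_pos_iff.2 (Complex.exp_ne_zero _)) 2
      have hlim := h.tendstoLocallyUniformlyOn.tendsto_at (Set.mem_univ t)
      exact ⟨_, half_pos hpos, (hlim.norm.pow 2).eventually
        (le_mem_nhds (half_lt_self hpos))⟩)
    (fun t η hη => eventually_norm_charFun_sq_le hinf c t hη)
  have hexp : TendstoLocallyUniformly (fun n t => Complex.exp
      (levyExponent (sumDrift (c n) (ν n) (kn n)) (sumMeasure (ν n) (kn n)) t))
      (fun t => Complex.exp (levyExponent γ σ t)) atTop := by
    rw [Metric.tendstoLocallyUniformly_iff] at h ⊢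
    intro ε hε x
    obtain ⟨U, hU, hUn⟩ := h (ε / 2) (half_pos hε) x
    have hB0 : 0 < |B| + 1 := by positivity
    refine ⟨U ∩ Metric.ball x 1, inter_mem hU (Metric.ball_mem_nhds x one_pos), ?_⟩
    filter_upwards [hUn, hB, eventually_norm_charFun_sub_exp_levyExponent_le hinf c (|x| + 1)
      (η := ε / 2 / (|B| + 1)) (by positivity)] with n h1 h2 h3 y hy
    have hy1 : |y| ≤ |x| + 1 := by
      have h4 := hy.2
      rw [Metric.mem_ball, Real.dist_eq] at h4
      have h5 := abs_sub_abs_le_abs_sub y x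
      linarith
    have h6 : ε / 2 / (|B| + 1) * (sumMeasure (ν n) (kn n)).real Set.univ ≤ ε / 2 := by
      rw [div_mul_eq_mul_div, div_le_iff₀ hB0]
      have := le_abs_self B
      gcongr
      linarith
    have h7 := h3 y hy1
    rw [← dist_eq_norm] at h7
    have h8 := dist_triangle (Complex.exp (levyExponent γ σ y)) (charFun (rhoN c kn ν n) y)
      (Complex.exp
        (levyExponent (sumDrift (c n) (ν n) (kn n)) (sumMeasure (ν n) (kn n)) y))
    linarith [h1 y hy.1]
  have hL := tendsto_of_tendstoLocallyUniformly_exp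
    (fun n => continuous_levyExponent _ _) (continuous_levyExponent γ σ)
    (fun n => levyExponent_zero _ _) (levyExponent_zero γ σ) hexp
  have hA : ∀ᶠ n in atTop, |sumDrift (c n) (ν n) (kn n)| ≤ ‖levyExponent γ σ 1‖ + 1 + 5 * B := by
    filter_upwards [hB, (hL 1).norm.eventually (ge_mem_nhds (lt_add_one _))] with n h1 h2
    have := abs_drift_le (sumDrift (c n) (ν n) (kn n)) (sumMeasure (ν n) (kn n))
    linarith
  simpa using (tendsto_sum_ET_sub_nevanlinna hinf c hB hz).add
    (tendsto_nevanlinna_of_tendsto_levyExponent hA hB hL hz)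

end LimitTheorem

/-- Theorem 5.3, (1) ⇔ (3): the classical convolutions ρ_n = δ_{c_n} * ν_{n1} * ⋯ * ν_{nk_n}
converge weakly to the *-infinitely divisible law ν_*^{γ,σ} (given by its Fourier transform)
iff the boolean convolutions ω_n = δ_{c_n} ⊎ ν_{n1} ⊎ ⋯ ⊎ ν_{nk_n} converge weakly to
ν_⊎^{γ,σ}. -/
theorem stmt19
    (kn : ℕ → ℕ) (ν : ℕ → ℕ → Measure ℝ)
    (hprob : ∀ n i, IsProbabilityMeasure (ν n i))
    (hinf : IsInfinitesimalArrayR kn ν)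
    (c : ℕ → ℝ) (γ : ℝ) (σ : Measure ℝ) (hσ : IsFiniteMeasure σ)
    (ω : ℕ → Measure ℝ) (hω : ∀ n, IsProbabilityMeasure (ω n))
    (hωE : ∀ n : ℕ, ∀ z : ℂ, 0 < z.im →
      ET (ω n) z = ((c n : ℝ) : ℂ) + ∑ i ∈ Finset.range (kn n), ET (ν n i) z)
    (νlim : Measure ℝ) (hνlim : IsProbabilityMeasure νlim)
    (hνE : ∀ z : ℂ, 0 < z.im →
      ET νlim z = ((γ : ℝ) : ℂ) + ∫ t : ℝ, (1 + (t : ℂ) * z) / (z - (t : ℂ)) ∂σ)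
    (ρstar : Measure ℝ) (hρstar : IsProbabilityMeasure ρstar)
    (hρhat : ∀ t : ℝ, (∫ x : ℝ, Complex.exp (Complex.I * t * x) ∂ρstar)
      = Complex.exp (Complex.I * γ * t + ∫ x : ℝ, levyKernel t x ∂σ)) :
    (∀ f : BoundedContinuousFunction ℝ ℝ,
      Tendsto (fun n => ∫ x, f x ∂(rhoN c kn ν n)) atTop (𝓝 (∫ x, f x ∂ρstar))) ↔
    (∀ f : BoundedContinuousFunction ℝ ℝ,
      Tendsto (fun n => ∫ x, f x ∂(ω n)) atTop (𝓝 (∫ x, f x ∂νlim))) := by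
  have hchar : charFun ρstar = fun t => Complex.exp (levyExponent γ σ t) := by
    funext t
    rw [charFun_apply_real, levyExponent, ← hρhat]
    congr 1 with x
    ring_nf
  let P : ℕ → ProbabilityMeasure ℝ := fun n => ⟨rhoN c kn ν n, inferInstance⟩
  let P₀ : ProbabilityMeasure ℝ := ⟨ρstar, hρstar⟩
  let Q : ℕ → ProbabilityMeasure ℝ := fun n => ⟨ω n, hω n⟩
  let Q₀ : ProbabilityMeasure ℝ := ⟨νlim, hνlim⟩
  suffices h : Tendsto P atTop (𝓝 P₀) ↔ Tendsto Q atTop (𝓝 Q₀) from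
    ProbabilityMeasure.tendsto_iff_forall_integral_tendsto.symm.trans
      (h.trans ProbabilityMeasure.tendsto_iff_forall_integral_tendsto)
  rw [tendsto_iff_tendsto_ET (μ := Q)]
  refine ⟨fun h z hz => ?_, fun h => ?_⟩
  · have hunif := tendstoLocallyUniformly_charFun h
    have hlim := tendsto_sum_ET_of_tendstoLocallyUniformly_charFun hinf c
      (γ := γ) (σ := σ) (hchar ▸ hunif) hz
    refine (hlim.congr fun n => (hωE n z hz).symm).trans_eq ?_
    exact congrArg 𝓝 (hνE z hz).symm
  · refine ProbabilityMeasure.tendsto_iff_tendsto_charFun.2 fun t => ?_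
    have hlim := tendsto_charFun_of_tendsto_sum_ET hinf c (γ := γ) (σ := σ) (fun z hz => by
      have h1 := (h z hz).congr fun n => hωE n z hz
      have h2 : nevanlinna γ σ z = ET νlim z := (hνE z hz).symm
      rw [h2]
      exact h1) t
    have h3 : charFun ρstar t = Complex.exp (levyExponent γ σ t) := congrFun hchar t
    rw [← h3] at hlim
    exact hlim

end
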